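/- arXiv:2411.15803 — 2 statements merged into one kernel-verified Lean document; each statement's English description precedes it below -/
import Mathlib

section
/- The singular value at 58 is k₅₈ = (√2 − 1)⁶·(13√58 − 99); that is, with q = exp(−π√58), one has θ₂(q)²/θ₃(q)² = (√2 − 1)⁶·(13√58 − 99). Moreover, x₅₈ = 2/(g₅₈¹² + g₅₈⁻¹²) = 1/9801. -/
open Real Filter

/-- The one-variable Jacobi theta function `θ₂(q) = ∑_{n ∈ ℤ} q^((n + 1/2)²)`. -/
noncomputable def theta2 (q : ℝ) : ℝ := ∑' n : ℤ, q ^ (((n : ℝ) + 1 / 2) ^ 2)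

/-- The one-variable Jacobi theta function `θ₃(q) = ∑_{n ∈ ℤ} q^(n²)`. -/
noncomputable def theta3 (q : ℝ) : ℝ := ∑' n : ℤ, q ^ ((n : ℝ) ^ 2)

/-- The singular value `k_r = λ*(r) = θ₂(q)²/θ₃(q)²` with `q = exp(−π√r)`. -/
noncomputable def kSing (r : ℝ) : ℝ :=
  theta2 (Real.exp (-(π * Real.sqrt r))) ^ 2 / theta3 (Real.exp (-(π * Real.sqrt r))) ^ 2

/-- The Ramanujan g-invariant `g_r = ((1 − k_r²)/(2 k_r))^(1/12)`. -/
noncomputable def gRam (r : ℝ) : ℝ := ((1 - kSing r ^ 2) / (2 * kSing r)) ^ ((1 : ℝ) / 12)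

/-! ### Representations by `x² + 58y²` -/

/-- The integral points on `x² + 58 y² = n`. -/
def repSet (n : ℤ) : Set (ℤ × ℤ) := {v | v.1 ^ 2 + 58 * v.2 ^ 2 = n}

theorem repSet_finite (n : ℤ) : (repSet n).Finite := by
  refine ((Set.finite_Icc (-n) n).prod (Set.finite_Icc (-n) n)).subset ?_
  rintro ⟨x, y⟩ h
  simp only [repSet, Set.mem_ofPred_eq] at h
  simp only [Set.mem_prod, Set.mem_Icc]
  have hx1 : x ≤ x ^ 2 := by nlinarith [sq_nonneg (x - 1), sq_nonneg x, Int.le_self_sq x]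
  have hx2 : -x ≤ x ^ 2 := by simpa using Int.le_self_sq (-x)
  have hy1 : y ≤ y ^ 2 := Int.le_self_sq y
  have hy2 : -y ≤ y ^ 2 := by simpa using Int.le_self_sq (-y)
  refine ⟨⟨?_, ?_⟩, ?_, ?_⟩ <;> nlinarith [sq_nonneg x, sq_nonneg y]

theorem repSet_four_mul (n : ℤ) : (repSet (4 * n)).ncard = (repSet n).ncard := by
  rw [← Set.ncard_image_of_injective (repSet n) (f := fun v : ℤ × ℤ => (2 * v.1, 2 * v.2))]
  · congr 1
    ext ⟨x, y⟩
    simp only [repSet, Set.mem_ofPred_eq, Set.mem_image, Prod.mk.injEq, Prod.exists]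
    constructor
    · intro h
      have hx : (2 : ℤ) ∣ x := by
        have : (2 : ℤ) ∣ x ^ 2 := ⟨2 * n - 29 * y ^ 2, by linarith⟩
        exact Int.prime_two.dvd_of_dvd_pow this
      obtain ⟨a, rfl⟩ := hx
      have hy : (2 : ℤ) ∣ y := by
        have : (2 : ℤ) ∣ y ^ 2 := by
          have : (2 : ℤ) ∣ 29 * y ^ 2 := ⟨n - a ^ 2, by linarith⟩
          omega
        exact Int.prime_two.dvd_of_dvd_pow this
      obtain ⟨b, rfl⟩ := hy
      exact ⟨a, b, by linarith, rfl, rfl⟩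
    · rintro ⟨a, b, h, rfl, rfl⟩
      linarith
  · rintro ⟨a, b⟩ ⟨c, d⟩ h
    simp only [Prod.mk.injEq] at h ⊢
    omega

theorem repSet_twentynine_mul (n : ℤ) : (repSet (29 * n)).ncard = (repSet (2 * n)).ncard := by
  have inj1 : Function.Injective (fun v : ℤ × ℤ => (2 * v.1, 2 * v.2)) := by
    rintro ⟨a, b⟩ ⟨c, d⟩ h
    simp only [Prod.mk.injEq] at h ⊢
    omega
  have inj2 : Function.Injective (fun v : ℤ × ℤ => (58 * v.2, v.1)) := by
    rintro ⟨a, b⟩ ⟨c, d⟩ h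
    simp only [Prod.mk.injEq] at h ⊢
    omega
  rw [← Set.ncard_image_of_injective (repSet (2 * n)) inj2,
    ← Set.ncard_image_of_injective (repSet (29 * n)) inj1]
  congr 1
  ext ⟨x, y⟩
  simp only [repSet, Set.mem_ofPred_eq, Set.mem_image, Prod.mk.injEq, Prod.exists]
  constructor
  · rintro ⟨a, b, h, rfl, rfl⟩
    have ha : (29 : ℤ) ∣ a := by
      have : (29 : ℤ) ∣ a ^ 2 := ⟨n - 2 * b ^ 2, by linarith⟩
      exact (Int.prime_iff_natAbs_prime.mpr (by norm_num)).dvd_of_dvd_pow this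
    obtain ⟨c, rfl⟩ := ha
    exact ⟨2 * b, c, by linarith, by ring, rfl⟩
  · rintro ⟨a, b, h, rfl, rfl⟩
    have ha : (2 : ℤ) ∣ a := by
      have : (2 : ℤ) ∣ a ^ 2 := ⟨n - 29 * b ^ 2, by linarith⟩
      exact Int.prime_two.dvd_of_dvd_pow this
    obtain ⟨c, rfl⟩ := ha
    exact ⟨29 * b, c, by linarith, by ring, rfl⟩

/-- Points whose image under multiplication by `p` lies on `x² + 58 y² = p n`. -/
def repSetDiv (p n : ℤ) : Set (ℤ × ℤ) := {v | p * (v.1 ^ 2 + 58 * v.2 ^ 2) = n}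

theorem smul_injective {p : ℤ} (hp : p ≠ 0) :
    Function.Injective (fun v : ℤ × ℤ => (p * v.1, p * v.2)) := by
  rintro ⟨a, b⟩ ⟨c, d⟩ h
  simpa [hp] using h

theorem image_repSetDiv {p : ℤ} (hp : p ≠ 0) (n : ℤ) :
    (fun v : ℤ × ℤ => (p * v.1, p * v.2)) '' repSetDiv p n =
      {v | v ∈ repSet (p * n) ∧ p ∣ v.1 ∧ p ∣ v.2} := by
  ext ⟨x, y⟩
  simp only [repSet, repSetDiv, Set.mem_ofPred_eq, Set.mem_image, Prod.mk.injEq, Prod.exists]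
  constructor
  · rintro ⟨a, b, h, rfl, rfl⟩
    exact ⟨by rw [← h]; ring, ⟨a, rfl⟩, ⟨b, rfl⟩⟩
  · rintro ⟨h, ⟨a, rfl⟩, ⟨b, rfl⟩⟩
    exact ⟨a, b, mul_left_cancel₀ hp (by rw [← h]; ring), rfl, rfl⟩

theorem prime_dvd_of_inert {p : ℤ} (hp : Prime p) (hn : ∀ b : ℤ, ¬ p ∣ b ^ 2 + 58)
    {x y : ℤ} (h : p ∣ x ^ 2 + 58 * y ^ 2) : p ∣ x ∧ p ∣ y := by
  have hy : p ∣ y := by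
    by_contra hy
    obtain ⟨a, b, hab⟩ := (Int.isCoprime_iff_gcd_eq_one.mpr
      ((Int.isCoprime_iff_gcd_eq_one.mp ((Prime.coprime_iff_not_dvd hp).mpr hy))))
    refine hn (b * x) ?_
    have : (b * x) ^ 2 + 58 = b ^ 2 * (x ^ 2 + 58 * y ^ 2) + p * (58 * a * (1 + b * y)) := by
      linear_combination (-58 * (1 + b * y)) * hab
    rw [this]
    exact dvd_add (dvd_mul_of_dvd_right h _) (dvd_mul_right _ _)
  refine ⟨?_, hy⟩
  have : p ∣ x ^ 2 := by
    have := dvd_sub h (dvd_mul_of_dvd_right (dvd_pow hy two_ne_zero) 58)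
    simpa using this
  exact hp.dvd_of_dvd_pow this

theorem repSet_mul_of_inert {p : ℤ} (hp : Prime p) (hn : ∀ b : ℤ, ¬ p ∣ b ^ 2 + 58) (n : ℤ) :
    (repSet (p * n)).ncard = (repSetDiv p n).ncard := by
  rw [← Set.ncard_image_of_injective (repSetDiv p n) (smul_injective hp.ne_zero),
    image_repSetDiv hp.ne_zero]
  congr 1
  ext ⟨x, y⟩
  simp only [Set.mem_ofPred_eq]
  refine ⟨fun h => ⟨h, prime_dvd_of_inert hp hn ⟨n, h⟩⟩, fun h => h.1⟩

/-- The Hecke relation at a prime `p` with `t p = u² + 58 v²`, `t ∈ {1, 2}`. -/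
theorem repSet_mul_of_split {p t u v : ℤ} (hp : Prime p) (hp2 : ¬ p ∣ 2) (hp29 : ¬ p ∣ 29)
    (ht : t = 1 ∨ t = 2) (huv : u ^ 2 + 58 * v ^ 2 = t * p) (n : ℤ) :
    (repSet (p * n)).ncard + (repSetDiv p n).ncard = 2 * (repSet (t * n)).ncard := by
  have hp0 := hp.ne_zero
  have ht0 : t ≠ 0 := by rcases ht with rfl | rfl <;> norm_num
  have hpt : ¬ p ∣ t := by
    rcases ht with rfl | rfl
    · exact hp.not_dvd_one
    · exact hp2
  have hp58 : ¬ p ∣ 58 := fun h => by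
    rcases hp.dvd_or_dvd (show p ∣ 2 * 29 from h) with h | h
    exacts [hp2 h, hp29 h]
  have hv : ¬ p ∣ v := by
    rintro ⟨w, rfl⟩
    have hu : p ∣ u := hp.dvd_of_dvd_pow (n := 2) ⟨t - 58 * p * w ^ 2, by linarith⟩
    obtain ⟨z, rfl⟩ := hu
    exact hpt ⟨z ^ 2 + 58 * w ^ 2, mul_left_cancel₀ hp0 (by linarith)⟩
  have hu : ¬ p ∣ u := by
    rintro ⟨z, rfl⟩
    have : p ∣ 58 * v ^ 2 := ⟨t - p * z ^ 2, by linarith⟩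
    rcases hp.dvd_or_dvd this with h | h
    exacts [hp58 h, hv (hp.dvd_of_dvd_pow h)]
  set I : Set (ℤ × ℤ) := {w | w ∈ repSet (p * n) ∧ p ∣ v * w.1 - u * w.2} with hI
  set J : Set (ℤ × ℤ) := {w | w ∈ repSet (p * n) ∧ p ∣ v * w.1 + u * w.2} with hJ
  have hIfin : I.Finite := (repSet_finite (p * n)).subset fun w hw => hw.1
  have hJfin : J.Finite := (repSet_finite (p * n)).subset fun w hw => hw.1
  have hunion : I ∪ J = repSet (p * n) := by
    ext ⟨x, y⟩
    simp only [hI, hJ, Set.mem_union, Set.mem_ofPred_eq]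
    constructor
    · rintro (h | h) <;> exact h.1
    · intro h
      have hd : p ∣ (v * x - u * y) * (v * x + u * y) := by
        refine ⟨v ^ 2 * n - t * y ^ 2, ?_⟩
        simp only [repSet, Set.mem_ofPred_eq] at h
        linear_combination v ^ 2 * h - y ^ 2 * huv
      exact (hp.dvd_or_dvd hd).imp (fun k => ⟨h, k⟩) (fun k => ⟨h, k⟩)
  have hinter : I ∩ J = (fun v : ℤ × ℤ => (p * v.1, p * v.2)) '' repSetDiv p n := by
    rw [image_repSetDiv hp0]
    ext ⟨x, y⟩
    simp only [hI, hJ, Set.mem_inter_iff, Set.mem_ofPred_eq]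
    constructor
    · rintro ⟨⟨h, h1⟩, -, h2⟩
      have hx : p ∣ 2 * (v * x) := by simpa [two_mul] using dvd_add h1 h2
      have hy : p ∣ 2 * (u * y) := by
        have := dvd_sub h2 h1
        ring_nf at this ⊢
        exact this
      refine ⟨h, ?_, ?_⟩
      · exact ((hp.dvd_or_dvd ((hp.dvd_or_dvd hx).resolve_left hp2)).resolve_left hv)
      · exact ((hp.dvd_or_dvd ((hp.dvd_or_dvd hy).resolve_left hp2)).resolve_left hu)
    · rintro ⟨h, hx, hy⟩
      exact ⟨⟨h, dvd_sub (dvd_mul_of_dvd_right hx _) (dvd_mul_of_dvd_right hy _)⟩,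
        h, dvd_add (dvd_mul_of_dvd_right hx _) (dvd_mul_of_dvd_right hy _)⟩
  have hJI : J.ncard = I.ncard := by
    have inj : Function.Injective (fun w : ℤ × ℤ => (w.1, -w.2)) := by
      rintro ⟨a, b⟩ ⟨c, d⟩ h
      simpa using h
    rw [← Set.ncard_image_of_injective I inj]
    congr 1
    ext ⟨x, y⟩
    simp only [hI, hJ, repSet, Set.mem_image, Set.mem_ofPred_eq, Prod.mk.injEq, Prod.exists]
    constructor
    · rintro ⟨h, h'⟩
      exact ⟨x, -y, ⟨by simpa using h, by simpa using h'⟩, rfl, by simp⟩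
    · rintro ⟨a, b, ⟨h, h'⟩, rfl, rfl⟩
      exact ⟨by simpa using h, by simpa [sub_eq_add_neg] using h'⟩
  have hIcard : I.ncard = (repSet (t * n)).ncard := by
    have inj : Function.Injective
        (fun w : ℤ × ℤ => (u * w.1 + 58 * v * w.2, u * w.2 - v * w.1)) := by
      rintro ⟨a, b⟩ ⟨c, d⟩ h
      simp only [Prod.mk.injEq] at h ⊢
      obtain ⟨h1, h2⟩ := h
      have htp : t * p ≠ 0 := mul_ne_zero ht0 hp0
      constructor
      · apply mul_left_cancel₀ htp
        linear_combination u * h1 - 58 * v * h2 - (a - c) * huv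
      · apply mul_left_cancel₀ htp
        linear_combination v * h1 + u * h2 - (b - d) * huv
    rw [← Set.ncard_image_of_injective I inj,
      ← Set.ncard_image_of_injective (repSet (t * n)) (smul_injective hp0)]
    congr 1
    ext ⟨x, y⟩
    simp only [hI, repSet, Set.mem_image, Set.mem_ofPred_eq, Prod.mk.injEq, Prod.exists]
    constructor
    · rintro ⟨a, b, ⟨h, k, hk⟩, rfl, rfl⟩
      have hA : p ∣ u * a + 58 * v * b := by
        apply hp.dvd_of_dvd_pow (n := 2)
        refine ⟨p * t * n - 58 * p * k ^ 2, ?_⟩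
        linear_combination (a ^ 2 + 58 * b ^ 2) * huv + t * p * h
          - 58 * (v * a - u * b + p * k) * hk
      obtain ⟨m, hm⟩ := hA
      refine ⟨m, -k, ?_, hm.symm, by linear_combination hk⟩
      apply mul_left_cancel₀ (mul_ne_zero hp0 hp0)
      linear_combination (a ^ 2 + 58 * b ^ 2) * huv + t * p * h
        - 58 * (v * a - u * b + p * k) * hk - (u * a + 58 * v * b + p * m) * hm
    · rintro ⟨a, b, h, rfl, rfl⟩
      obtain ⟨X, Y, hX, hY⟩ : ∃ X Y : ℤ, t * X = u * a - 58 * v * b ∧ t * Y = u * b + v * a := by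
        rcases ht with rfl | rfl
        · exact ⟨_, _, one_mul _, one_mul _⟩
        · have h1 : (2 : ℤ) ∣ u := Int.prime_two.dvd_of_dvd_pow (n := 2)
            ⟨p - 29 * v ^ 2, by linarith⟩
          have h2 : (2 : ℤ) ∣ a := Int.prime_two.dvd_of_dvd_pow (n := 2)
            ⟨n - 29 * b ^ 2, by linarith⟩
          obtain ⟨u', rfl⟩ := h1
          obtain ⟨a', rfl⟩ := h2
          exact ⟨2 * u' * a' - 29 * v * b, u' * b + v * a', by ring, by ring⟩
      refine ⟨X, Y, ⟨?_, ⟨-b, ?_⟩⟩, ?_, ?_⟩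
      · apply mul_left_cancel₀ (mul_ne_zero ht0 ht0)
        linear_combination (t * X + (u * a - 58 * v * b)) * hX +
          58 * (t * Y + (u * b + v * a)) * hY + (a ^ 2 + 58 * b ^ 2) * huv + t * p * h
      · apply mul_left_cancel₀ ht0
        linear_combination v * hX - u * hY - b * huv
      · apply mul_left_cancel₀ ht0
        linear_combination u * hX + 58 * v * hY + a * huv
      · apply mul_left_cancel₀ ht0
        linear_combination u * hY - v * hX + b * huv
  have := Set.ncard_union_add_ncard_inter I J hIfin hJfin
  rw [hunion, hinter, Set.ncard_image_of_injective _ (smul_injective hp0), hJI, hIcard] at this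
  omega

/-- Every binary quadratic form `n x² + 2b x y + c y²` of discriminant `-232` represents
`1` or `2`. -/
theorem exists_form_eq_one_or_two (n : ℕ) (hn : 0 < n) (b c : ℤ) (h : n * c = b ^ 2 + 58) :
    ∃ x y : ℤ, n * x ^ 2 + 2 * b * x * y + c * y ^ 2 = 1 ∨
      n * x ^ 2 + 2 * b * x * y + c * y ^ 2 = 2 := by
  induction n using Nat.strong_induction_on generalizing b c with
  | _ n ih =>
  have hn' : (0 : ℤ) < n := by exact_mod_cast hn
  obtain ⟨k, b', hb, hb'⟩ : ∃ k b' : ℤ, b' = b - k * n ∧ 2 * |b'| ≤ n := by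
    refine ⟨(2 * b + n) / (2 * n), b - (2 * b + n) / (2 * n) * n, rfl, ?_⟩
    have h1 := Int.emod_add_mul_ediv (2 * b + n) (2 * n)
    have h2 := Int.emod_nonneg (2 * b + n) (show (2 * n : ℤ) ≠ 0 by positivity)
    have h3 := Int.emod_lt_of_pos (2 * b + n) (show (0 : ℤ) < 2 * n by positivity)
    have h4 : 2 * |b - (2 * b + n) / (2 * n) * n| = |2 * (b - (2 * b + n) / (2 * n) * n)| := by
      rw [abs_mul]; rfl
    rw [h4, abs_le]
    constructor <;> nlinarith
  obtain ⟨c', hc'⟩ : ∃ c' : ℤ, c' = c - 2 * k * b + k ^ 2 * n := ⟨_, rfl⟩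
  have hdisc : n * c' = b' ^ 2 + 58 := by subst hb hc'; linear_combination h
  have hsq : b' ^ 2 = |b'| ^ 2 := (sq_abs b').symm
  have habs := abs_nonneg b'
  have hc'pos : 0 < c' := by
    by_contra hcon
    nlinarith [sq_nonneg b', mul_nonneg hn'.le (neg_nonneg.mpr (not_lt.mp hcon))]
  suffices H : ∃ x y : ℤ, n * x ^ 2 + 2 * b' * x * y + c' * y ^ 2 = 1 ∨
      n * x ^ 2 + 2 * b' * x * y + c' * y ^ 2 = 2 by
    obtain ⟨x, y, hxy⟩ := H
    refine ⟨x - k * y, y, ?_⟩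
    have : n * (x - k * y) ^ 2 + 2 * b * (x - k * y) * y + c * y ^ 2 =
        n * x ^ 2 + 2 * b' * x * y + c' * y ^ 2 := by subst hb hc'; ring
    rwa [this]
  rcases lt_or_ge c' n with hlt | hge
  · obtain ⟨m, rfl⟩ : ∃ m : ℕ, c' = m := ⟨c'.toNat, by omega⟩
    obtain ⟨x, y, hxy⟩ := ih m (by exact_mod_cast hlt) (by exact_mod_cast hc'pos) b' n
      (by linarith)
    refine ⟨y, x, ?_⟩
    have : (n : ℤ) * y ^ 2 + 2 * b' * y * x + m * x ^ 2 =
        m * x ^ 2 + 2 * b' * x * y + n * y ^ 2 := by ring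
    rwa [this]
  · have hn8 : (n : ℤ) ≤ 8 := by nlinarith
    obtain ⟨hb1, hb2⟩ := abs_le.mp (show |b'| ≤ 4 by omega)
    have hn8' : n ≤ 8 := by exact_mod_cast hn8
    clear hb hc' h ih hsq
    interval_cases n
    · exact ⟨1, 0, by norm_num⟩
    · exact ⟨1, 0, by norm_num⟩
    all_goals (exfalso; interval_cases b' <;> simp at hb' <;> omega)

/-! ### Dirichlet convolution of completely multiplicative functions -/

/-- The Dirichlet convolution of `f` and `g`. -/
def dirConv (f g : ℕ → ℤ) (n : ℕ) : ℤ := ∑ x ∈ n.divisorsAntidiagonal, f x.1 * g x.2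

theorem sum_filter_dvd_fst {f g : ℕ → ℤ} (hf : ∀ m n, f (m * n) = f m * f n) {p : ℕ}
    (hp : 0 < p) (m : ℕ) :
    ∑ x ∈ (p * m).divisorsAntidiagonal with p ∣ x.1, f x.1 * g x.2 = f p * dirConv f g m := by
  rw [dirConv, Finset.mul_sum]
  symm
  refine Finset.sum_nbij (fun x => (p * x.1, x.2)) ?_ ?_ ?_ ?_
  · rintro ⟨d, e⟩ h
    simp only [Nat.mem_divisorsAntidiagonal, Finset.mem_filter] at h ⊢
    refine ⟨⟨by rw [← h.1]; ring, mul_ne_zero hp.ne' h.2⟩, dvd_mul_right _ _⟩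
  · rintro ⟨d, e⟩ - ⟨d', e'⟩ - h
    simpa [hp.ne'] using h
  · rintro ⟨d, e⟩ h
    simp only [Finset.coe_filter, Set.mem_ofPred_eq, Nat.mem_divisorsAntidiagonal] at h
    obtain ⟨⟨h1, h2⟩, k, rfl⟩ := h
    refine ⟨(k, e), ?_, rfl⟩
    simp only [Finset.mem_coe, Nat.mem_divisorsAntidiagonal]
    exact ⟨mul_left_cancel₀ hp.ne' (by rw [← h1]; ring), fun h => h2 (by rw [h, mul_zero])⟩
  · rintro ⟨d, e⟩ -
    simp only [hf]
    ring

theorem dirConv_comm (f g : ℕ → ℤ) (n : ℕ) : dirConv f g n = dirConv g f n := by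
  rw [dirConv, dirConv, ← Nat.map_swap_divisorsAntidiagonal, Finset.sum_map]
  simp [mul_comm]

theorem sum_filter_dvd_snd {f g : ℕ → ℤ} (hg : ∀ m n, g (m * n) = g m * g n) {p : ℕ}
    (hp : 0 < p) (m : ℕ) :
    ∑ x ∈ (p * m).divisorsAntidiagonal with p ∣ x.2, f x.1 * g x.2 = g p * dirConv f g m := by
  rw [dirConv_comm, ← sum_filter_dvd_fst hg hp]
  refine Finset.sum_nbij' Prod.swap Prod.swap ?_ ?_ ?_ ?_ ?_ <;>
    simp +contextual [mul_comm]

theorem sum_filter_dvd_both {f g : ℕ → ℤ} (hf : ∀ m n, f (m * n) = f m * f n)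
    (hg : ∀ m n, g (m * n) = g m * g n) {p : ℕ} (hp : 0 < p) (m : ℕ) :
    ∑ x ∈ (p * m).divisorsAntidiagonal with p ∣ x.1 ∧ p ∣ x.2, f x.1 * g x.2 =
      f p * g p * if p ∣ m then dirConv f g (m / p) else 0 := by
  split_ifs with h
  · obtain ⟨k, rfl⟩ := h
    rw [Nat.mul_div_cancel_left _ hp, mul_assoc, ← sum_filter_dvd_snd hg hp, Finset.mul_sum]
    symm
    refine Finset.sum_nbij (fun x => (p * x.1, x.2)) ?_ ?_ ?_ ?_
    · rintro ⟨d, e⟩ h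
      simp only [Nat.mem_divisorsAntidiagonal, Finset.mem_filter] at h ⊢
      refine ⟨⟨by rw [← h.1.1]; ring, mul_ne_zero hp.ne' h.1.2⟩, dvd_mul_right _ _, h.2⟩
    · rintro ⟨d, e⟩ - ⟨d', e'⟩ - h
      simpa [hp.ne'] using h
    · rintro ⟨d, e⟩ h
      simp only [Finset.coe_filter, Set.mem_ofPred_eq, Nat.mem_divisorsAntidiagonal] at h
      obtain ⟨⟨h1, h2⟩, ⟨l, rfl⟩, h3⟩ := h
      refine ⟨(l, e), ?_, rfl⟩
      simp only [Finset.coe_filter, Set.mem_ofPred_eq, Nat.mem_divisorsAntidiagonal]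
      exact ⟨⟨mul_left_cancel₀ hp.ne' (by rw [← h1]; ring), fun h => h2 (by rw [h, mul_zero])⟩, h3⟩
    · rintro ⟨d, e⟩ -
      simp only [hf]
      ring
  · rw [mul_zero]
    refine Finset.sum_eq_zero ?_
    rintro ⟨d, e⟩ hde
    simp only [Nat.mem_divisorsAntidiagonal, Finset.mem_filter] at hde
    obtain ⟨⟨h1, -⟩, ⟨a, rfl⟩, b, rfl⟩ := hde
    exact absurd ⟨a * b, mul_left_cancel₀ hp.ne' (by rw [← h1]; ring)⟩ h

theorem dirConv_prime_mul {f g : ℕ → ℤ} (hf : ∀ m n, f (m * n) = f m * f n)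
    (hg : ∀ m n, g (m * n) = g m * g n) {p : ℕ} (hp : p.Prime) (m : ℕ) :
    dirConv f g (p * m) + f p * g p * (if p ∣ m then dirConv f g (m / p) else 0) =
      (f p + g p) * dirConv f g m := by
  rw [add_mul, ← sum_filter_dvd_fst hf hp.pos, ← sum_filter_dvd_snd hg hp.pos,
    ← sum_filter_dvd_both hf hg hp.pos, ← Finset.sum_union_inter, ← Finset.filter_or,
    ← Finset.filter_and, dirConv]
  congr 2
  refine (Finset.filter_true_of_mem ?_).symm
  rintro ⟨d, e⟩ h
  exact (hp.dvd_mul).mp (by rw [(Nat.mem_divisorsAntidiagonal.mp h).1]; exact dvd_mul_right _ _)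

/-! ### The genus theory of discriminant `-232` -/

/-- The quadratic character of conductor `29`. -/
def chi29 (n : ℕ) : ℤ := jacobiSym n 29

/-- The quadratic character attached to `ℚ(√-2)`. -/
def chiNegEight (n : ℕ) : ℤ := ZMod.χ₈' n

theorem chi29_mul (m n : ℕ) : chi29 (m * n) = chi29 m * chi29 n := by
  simp [chi29, jacobiSym.mul_left]

theorem chiNegEight_mul (m n : ℕ) : chiNegEight (m * n) = chiNegEight m * chiNegEight n := by
  rw [chiNegEight, Nat.cast_mul, map_mul]
  rfl

theorem repSetDiv_ncard {p : ℕ} (hp : 0 < p) (m : ℕ) :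
    (repSetDiv p m).ncard = if p ∣ m then (repSet ((m / p : ℕ) : ℤ)).ncard else 0 := by
  split_ifs with h
  · obtain ⟨k, rfl⟩ := h
    rw [Nat.mul_div_cancel_left _ hp]
    congr 1
    ext v
    simp only [repSetDiv, repSet, Set.mem_ofPred_eq]
    push_cast
    exact mul_right_inj' (by exact_mod_cast hp.ne')
  · convert Set.ncard_empty (ℤ × ℤ)
    ext v
    simp only [repSetDiv, Set.mem_ofPred_eq, Set.mem_empty_iff_false, iff_false]
    intro hv
    exact h (Int.natCast_dvd_natCast.mp ⟨_, hv.symm⟩)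

/-- The difference of the numbers of representations of `n` by `x² + 58 y²` and
`2 x² + 29 y²`. -/
noncomputable def repDiff (n : ℕ) : ℤ := (repSet n).ncard - (repSet (2 * n)).ncard

theorem repDiff_two_mul (n : ℕ) : repDiff (2 * n) = -repDiff n := by
  have := repSet_four_mul n
  simp only [repDiff]
  push_cast
  rw [← mul_assoc, show (2 * 2 : ℤ) = 4 by norm_num, this]
  ring

theorem repDiff_twentynine_mul (n : ℕ) : repDiff (29 * n) = -repDiff n := by
  have h1 := repSet_twentynine_mul n
  have h2 := repSet_twentynine_mul (2 * n)
  have h3 := repSet_four_mul n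
  simp only [repDiff]
  push_cast
  rw [h1, mul_left_comm, h2, ← mul_assoc, show (2 * 2 : ℤ) = 4 by norm_num, h3]
  ring

theorem repDiff_prime_mul {p : ℕ} (hp : p.Prime) (hp2 : p ≠ 2) (hp29 : p ≠ 29) (m : ℕ) :
    repDiff (p * m) + chi29 p * chiNegEight p * (if p ∣ m then repDiff (m / p) else 0) =
      (chi29 p + chiNegEight p) * repDiff m := by
  have : Fact p.Prime := ⟨hp⟩
  have hpZ : Prime (p : ℤ) := Nat.prime_iff_prime_int.mp hp
  have hodd : Odd p := hp.odd_of_ne_two hp2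
  have hd2 : ¬ (p : ℤ) ∣ 2 := fun h =>
    hp2 ((Nat.prime_dvd_prime_iff_eq hp Nat.prime_two).mp (by exact_mod_cast h))
  have hd29 : ¬ (p : ℤ) ∣ 29 := fun h =>
    hp29 ((Nat.prime_dvd_prime_iff_eq hp (by norm_num)).mp (by exact_mod_cast h))
  have hdvd : p ∣ 2 * m ↔ p ∣ m :=
    ⟨fun h => (hp.dvd_mul.mp h).resolve_left
      (fun h => hp2 ((Nat.prime_dvd_prime_iff_eq hp Nat.prime_two).mp h)),
      fun h => dvd_mul_of_dvd_right h _⟩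
  have hT1 := repSetDiv_ncard hp.pos m
  have hT2 := repSetDiv_ncard hp.pos (2 * m)
  have hTdiff : ((repSetDiv p m).ncard : ℤ) - (repSetDiv p (2 * m : ℕ)).ncard =
      if p ∣ m then repDiff (m / p) else 0 := by
    rw [hT1, hT2]
    simp only [hdvd]
    split_ifs with h
    · rw [repDiff, Nat.mul_div_assoc 2 h]
      push_cast
      rfl
    · simp
  have hchi : legendreSym p (-58) = chi29 p * chiNegEight p := by
    rw [jacobiSym.legendreSym.to_jacobiSym, show (-58 : ℤ) = -2 * (29 : ℕ) by norm_num,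
      jacobiSym.mul_left, jacobiSym.at_neg_two hodd,
      jacobiSym.quadratic_reciprocity_one_mod_four (by norm_num) hodd, mul_comm]
    rfl
  have hne : ((-58 : ℤ) : ZMod p) ≠ 0 := by
    rw [Ne, ZMod.intCast_zmod_eq_zero_iff_dvd, dvd_neg]
    intro h
    rcases hpZ.dvd_or_dvd (show (p : ℤ) ∣ 2 * 29 from h) with h | h
    exacts [hd2 h, hd29 h]
  have key : ∀ t : ℤ, (p : ℤ) * (t * m) = t * (p * m) := fun t => by ring
  rw [← hTdiff]
  by_cases hsplit : ∃ b : ℤ, (p : ℤ) ∣ b ^ 2 + 58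
  · obtain ⟨b, c, hbc⟩ := hsplit
    have h1 : legendreSym p (-58) = 1 := by
      rw [legendreSym.eq_one_iff p hne]
      refine ⟨(b : ZMod p), ?_⟩
      have : ((b ^ 2 + 58 : ℤ) : ZMod p) = 0 := by rw [hbc]; simp
      push_cast at this ⊢
      linear_combination -this
    rw [hchi] at h1
    obtain ⟨x, y, hxy⟩ := exists_form_eq_one_or_two p hp.pos b c hbc.symm
    obtain ⟨t, ht, hxy⟩ : ∃ t : ℤ, (t = 1 ∨ t = 2) ∧
        p * x ^ 2 + 2 * b * x * y + c * y ^ 2 = t := by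
      rcases hxy with h | h
      exacts [⟨1, Or.inl rfl, h⟩, ⟨2, Or.inr rfl, h⟩]
    have huv : (p * x + b * y) ^ 2 + 58 * y ^ 2 = t * p := by
      rw [← hxy]; linear_combination y ^ 2 * hbc
    have hgen : chi29 p = jacobiSym t 29 := by
      have hsq : jacobiSym ((p * x + b * y) ^ 2) 29 = jacobiSym (t * p) 29 := by
        rw [jacobiSym.mod_left, jacobiSym.mod_left (t * p), ← huv]
        congr 1
        omega
      have hcop : IsCoprime (p * x + b * y) (29 : ℤ) := by
        rw [isCoprime_comm, Prime.coprime_iff_not_dvd (Int.prime_iff_natAbs_prime.mpr (by norm_num))]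
        intro h
        have : (29 : ℤ) ∣ t * p := by
          rw [← huv]
          exact dvd_add (dvd_pow h two_ne_zero) ⟨2 * y ^ 2, by ring⟩
        rcases (Int.prime_iff_natAbs_prime.mpr (by norm_num) : Prime (29 : ℤ)).dvd_or_dvd this
          with h | h
        · rcases ht with rfl | rfl <;> omega
        · exact hp29 ((Nat.prime_dvd_prime_iff_eq (by norm_num) hp).mp (by exact_mod_cast h)).symm
      rw [jacobiSym.sq_one' (Int.isCoprime_iff_gcd_eq_one.mp hcop), jacobiSym.mul_left] at hsq
      change 1 = jacobiSym t 29 * chi29 p at hsq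
      rcases ht with rfl | rfl
      · simpa using hsq.symm
      · have : jacobiSym 2 29 = -1 := by norm_num
        rw [this] at hsq ⊢
        linarith
    have e1 := repSet_mul_of_split hpZ hd2 hd29 ht huv m
    have e2 := repSet_mul_of_split hpZ hd2 hd29 ht huv (2 * m)
    rw [key 2] at e2
    simp only [repDiff]
    rw [h1]
    push_cast
    rcases ht with rfl | rfl
    · have h29 : chi29 p = 1 := by rw [hgen]; norm_num
      have h8 : chiNegEight p = 1 := by rw [h29] at h1; linarith
      rw [h29, h8]
      simp only [one_mul] at e1 e2 ⊢
      omega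
    · have h29 : chi29 p = -1 := by rw [hgen]; norm_num
      have h8 : chiNegEight p = -1 := by rw [h29] at h1; linarith
      have e3 := repSet_four_mul m
      rw [show (2 * (2 * m) : ℤ) = 4 * m by ring, e3] at e2
      rw [h29, h8]
      omega
  · push Not at hsplit
    have h1 : legendreSym p (-58) = -1 := by
      rw [legendreSym.eq_neg_one_iff]
      rintro ⟨r, hr⟩
      refine hsplit (r.val : ℤ) ((ZMod.intCast_zmod_eq_zero_iff_dvd _ p).mp ?_)
      push_cast
      rw [ZMod.natCast_zmod_val]
      push_cast at hr
      linear_combination -hr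
    rw [hchi] at h1
    have hzero : chi29 p + chiNegEight p = 0 := by
      rcases Int.eq_one_or_neg_one_of_mul_eq_neg_one' h1 with ⟨h, h'⟩ | ⟨h, h'⟩ <;> rw [h, h'] <;> rfl
    have e1 := repSet_mul_of_inert hpZ hsplit m
    have e2 := repSet_mul_of_inert hpZ hsplit (2 * m)
    rw [key 2] at e2
    rw [h1, hzero]
    simp only [repDiff]
    push_cast
    rw [e1, e2]
    ring

theorem repSet_one : repSet 1 = {(1, 0), (-1, 0)} := by
  ext ⟨x, y⟩
  simp only [repSet, Set.mem_ofPred_eq, Set.mem_insert_iff, Set.mem_singleton_iff, Prod.mk.injEq]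
  constructor
  · intro h
    have hy : y = 0 := by nlinarith [sq_nonneg x, sq_nonneg y, Int.le_self_sq y, Int.le_self_sq (-y)]
    subst hy
    have : x ^ 2 = 1 := by linarith
    rcases sq_eq_one_iff.mp this with h | h <;> simp [h]
  · rintro (⟨rfl, rfl⟩ | ⟨rfl, rfl⟩) <;> norm_num

theorem repSet_two : repSet 2 = ∅ := by
  ext ⟨x, y⟩
  simp only [repSet, Set.mem_ofPred_eq, Set.mem_empty_iff_false, iff_false]
  intro h
  have hy : y = 0 := by nlinarith [sq_nonneg x, sq_nonneg y, Int.le_self_sq y, Int.le_self_sq (-y)]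
  subst hy
  have h1 : x < 2 := by nlinarith
  have h2 : -2 < x := by nlinarith
  interval_cases x <;> omega

/-- Genus theory: the difference of the representation numbers of the two forms of
discriminant `-232` is a convolution of two quadratic characters. -/
theorem repDiff_eq (n : ℕ) (hn : n ≠ 0) : repDiff n = 2 * dirConv chi29 chiNegEight n := by
  induction n using Nat.strong_induction_on with
  | _ n ih =>
  rcases eq_or_ne n 1 with rfl | h1
  · have : repDiff 1 = 2 := by
      simp only [repDiff, Nat.cast_one, mul_one]
      rw [repSet_one, repSet_two, Set.ncard_pair (by norm_num)]
      simp
    rw [this]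
    simp [dirConv, chi29, chiNegEight]
  · obtain ⟨p, hp, m, rfl⟩ := Nat.exists_prime_and_dvd h1
    have hm : m ≠ 0 := right_ne_zero_of_mul hn
    have hlt : m < p * m := lt_mul_of_one_lt_left (Nat.pos_of_ne_zero hm) hp.one_lt
    have ihm := ih m hlt hm
    have hconv := dirConv_prime_mul chi29_mul chiNegEight_mul hp m
    rcases eq_or_ne p 2 with rfl | hp2
    · have h29 : chi29 2 = -1 := by norm_num [chi29]
      have h8 : chiNegEight 2 = 0 := by decide
      rw [h29, h8] at hconv
      rw [repDiff_two_mul, ihm]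
      linarith
    rcases eq_or_ne p 29 with rfl | hp29
    · have h29 : chi29 29 = 0 := by norm_num [chi29]
      have h8 : chiNegEight 29 = -1 := by decide
      rw [h29, h8] at hconv
      rw [repDiff_twentynine_mul, ihm]
      linarith
    have hrep := repDiff_prime_mul hp hp2 hp29 m
    have hdiv : (if p ∣ m then repDiff (m / p) else 0) =
        2 * if p ∣ m then dirConv chi29 chiNegEight (m / p) else 0 := by
      split_ifs with h
      · refine ih _ ((Nat.div_le_self m p).trans_lt hlt) ?_
        exact (Nat.div_pos (Nat.le_of_dvd (Nat.pos_of_ne_zero hm) h) hp.pos).ne'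
      · simp
    rw [hdiv, ihm] at hrep
    linarith

/-! ### Values at `s = 1` of Dirichlet series -/

section DirichletLimit

open MeasureTheory Set Topology

theorem integrableOn_rpow_mul_exp_neg {s : ℝ} (hs : 0 < s) {r : ℝ} (hr : 0 < r) :
    IntegrableOn (fun t : ℝ => t ^ (s - 1) * Real.exp (-(r * t))) (Ioi 0) := by
  refine .of_integral_ne_zero ?_
  rw [Real.integral_rpow_mul_exp_neg_mul_Ioi hs hr]
  have := Real.Gamma_pos_of_pos hs
  positivity

theorem gamma_mul_dirichletSeries {f : ℕ → ℝ} (hf : ∀ n, |f n| ≤ 1) {g : ℝ → ℝ}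
    (hg : ∀ x ∈ Ioo (0 : ℝ) 1, HasSum (fun n => f n * x ^ n) (g x)) {s : ℝ} (hs : 1 < s) :
    Real.Gamma s * ∑' n : ℕ, f n * ((n : ℝ) + 1) ^ (-s) =
      ∫ t in Ioi (0 : ℝ), t ^ (s - 1) * (Real.exp (-t) * g (Real.exp (-t))) := by
  have hs0 : 0 < s := by linarith
  have hGamma := Real.Gamma_pos_of_pos hs0
  have hpos : ∀ n : ℕ, (0 : ℝ) < n + 1 := fun n => by positivity
  have hintegral : ∀ n : ℕ, ∫ t in Ioi (0 : ℝ), t ^ (s - 1) * Real.exp (-(((n : ℝ) + 1) * t)) =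
      ((n : ℝ) + 1) ^ (-s) * Real.Gamma s := fun n => by
    rw [Real.integral_rpow_mul_exp_neg_mul_Ioi hs0 (hpos n), one_div,
      Real.inv_rpow (hpos n).le, Real.rpow_neg (hpos n).le]
  have hsum : Summable fun n : ℕ => ((n : ℝ) + 1) ^ (-s) := by
    have := (summable_nat_add_iff 1).mpr (Real.summable_nat_rpow.mpr (show -s < -1 by linarith))
    simpa using this
  have key := hasSum_integral_of_summable_integral_norm (μ := volume.restrict (Ioi (0 : ℝ)))
    (F := fun (n : ℕ) (t : ℝ) => f n * (t ^ (s - 1) * Real.exp (-(((n : ℝ) + 1) * t))))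
    (fun n => (integrableOn_rpow_mul_exp_neg hs0 (hpos n)).const_mul _) ?_
  · rw [← tsum_mul_left]
    simp only [integral_const_mul, hintegral] at key
    have h2 : (fun n : ℕ => Real.Gamma s * (f n * ((n : ℝ) + 1) ^ (-s))) =
        fun n : ℕ => f n * (((n : ℝ) + 1) ^ (-s) * Real.Gamma s) := by
      funext n; ring
    rw [h2, key.tsum_eq]
    refine setIntegral_congr_fun measurableSet_Ioi fun t ht => ?_
    have ht : 0 < t := ht
    have hx : Real.exp (-t) ∈ Ioo (0 : ℝ) 1 := ⟨Real.exp_pos _, by simpa using ht⟩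
    have := ((hg _ hx).mul_left (t ^ (s - 1) * Real.exp (-t))).tsum_eq
    rw [← mul_assoc, ← this]
    refine tsum_congr fun n => ?_
    rw [← Real.exp_nat_mul, show -(((n : ℝ) + 1) * t) = n * -t + -t by ring, Real.exp_add]
    ring
  · refine (hsum.mul_right (Real.Gamma s)).of_nonneg_of_le
      (fun n => integral_nonneg fun t => norm_nonneg _) fun n => ?_
    rw [← hintegral]
    refine setIntegral_mono_on ?_ (integrableOn_rpow_mul_exp_neg hs0 (hpos n)) measurableSet_Ioi ?_
    · exact ((integrableOn_rpow_mul_exp_neg hs0 (hpos n)).const_mul _).norm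
    · intro t ht
      have ht : 0 < t := ht
      rw [norm_mul, Real.norm_eq_abs, Real.norm_of_nonneg (by positivity)]
      exact mul_le_of_le_one_left (by positivity) (hf n)

/-- If `∑ f n xⁿ` has a primitive `H` that is regular on `[0, 1]`, then
`∑ f n (n + 1)^(-s)` tends to `H 1 - H 0` as `s → 1⁺`. -/
theorem tendsto_dirichletSeries {f : ℕ → ℝ} (hf : ∀ n, |f n| ≤ 1) {g H : ℝ → ℝ}
    (hg : ∀ x ∈ Ioo (0 : ℝ) 1, HasSum (fun n => f n * x ^ n) (g x))
    (hgc : ContinuousOn g (Icc 0 1)) (hH : ∀ x ∈ Icc (0 : ℝ) 1, HasDerivAt H (g x) x) :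
    Tendsto (fun s : ℝ => ∑' n : ℕ, f n * ((n : ℝ) + 1) ^ (-s)) (𝓝[>] 1) (𝓝 (H 1 - H 0)) := by
  obtain ⟨C, hC⟩ := isCompact_Icc.exists_bound_of_continuousOn hgc
  have hmem : ∀ t ∈ Ioi (0 : ℝ), Real.exp (-t) ∈ Icc (0 : ℝ) 1 := fun t ht =>
    ⟨(Real.exp_pos _).le, by have : 0 < t := ht; simpa using this.le⟩
  have hgexp : ContinuousOn (fun t => Real.exp (-t) * g (Real.exp (-t))) (Ioi (0 : ℝ)) := by
    refine ContinuousOn.mul (by fun_prop) (hgc.comp (by fun_prop) hmem)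
  have hbi : IntegrableOn (fun t : ℝ => C * ((1 + t) * Real.exp (-t))) (Ioi 0) := by
    have h1 := integrableOn_rpow_mul_exp_neg (s := 1) one_pos one_pos
    have h2 := integrableOn_rpow_mul_exp_neg (s := 2) two_pos one_pos
    refine ((h1.add h2).congr_fun (fun t ht => ?_) measurableSet_Ioi).const_mul C
    norm_num
    ring
  have hCnn : 0 ≤ C := (norm_nonneg _).trans (hC 0 (by simp))
  have hgb : ∀ t ∈ Ioi (0 : ℝ), ‖Real.exp (-t) * g (Real.exp (-t))‖ ≤ C * Real.exp (-t) := by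
    intro t ht
    rw [norm_mul, Real.norm_of_nonneg (Real.exp_pos _).le, mul_comm]
    exact mul_le_mul_of_nonneg_right (hC _ (hmem t ht)) (Real.exp_pos _).le
  have hlim : Tendsto (fun s : ℝ => ∫ t in Ioi (0 : ℝ),
      t ^ (s - 1) * (Real.exp (-t) * g (Real.exp (-t)))) (𝓝[>] 1)
      (𝓝 (∫ t in Ioi (0 : ℝ), Real.exp (-t) * g (Real.exp (-t)))) := by
    refine tendsto_integral_filter_of_dominated_convergence
      (fun t => C * ((1 + t) * Real.exp (-t))) ?_ ?_ hbi ?_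
    · refine Eventually.of_forall fun s => ?_
      refine ContinuousOn.aestronglyMeasurable (ContinuousOn.mul ?_ hgexp) measurableSet_Ioi
      exact fun t ht => (Real.continuousAt_rpow_const _ _ (Or.inl (ne_of_gt ht))).continuousWithinAt
    · have : Ioo (1 : ℝ) 2 ∈ 𝓝[>] (1 : ℝ) := Ioo_mem_nhdsGT (by norm_num)
      filter_upwards [this] with s hs
      refine (ae_restrict_iff' measurableSet_Ioi).mpr (Eventually.of_forall fun t ht => ?_)
      have ht' : 0 < t := ht
      have hpow : t ^ (s - 1) ≤ 1 + t := by
        rcases le_total t 1 with h | h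
        · exact (Real.rpow_le_one ht'.le h (by linarith [hs.1])).trans (by linarith)
        · calc t ^ (s - 1) ≤ t ^ (1 : ℝ) :=
                Real.rpow_le_rpow_of_exponent_le h (by linarith [hs.2])
            _ ≤ 1 + t := by rw [Real.rpow_one]; linarith
      rw [norm_mul, Real.norm_of_nonneg (by positivity)]
      calc t ^ (s - 1) * ‖Real.exp (-t) * g (Real.exp (-t))‖
          ≤ (1 + t) * (C * Real.exp (-t)) :=
            mul_le_mul hpow (hgb t ht) (norm_nonneg _) (by positivity)
        _ = _ := by ring
    · refine (ae_restrict_iff' measurableSet_Ioi).mpr (Eventually.of_forall fun t ht => ?_)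
      have ht' : 0 < t := ht
      have h1 : Tendsto (fun s : ℝ => t ^ (s - 1)) (𝓝[>] 1) (𝓝 (t ^ ((1 : ℝ) - 1))) :=
        ((Real.continuous_const_rpow ht'.ne').comp
          (continuous_id.sub continuous_const)).continuousAt.mono_left nhdsWithin_le_nhds
      simpa using h1.mul_const (Real.exp (-t) * g (Real.exp (-t)))
  have hval : ∫ t in Ioi (0 : ℝ), Real.exp (-t) * g (Real.exp (-t)) = H 1 - H 0 := by
    have hd : ∀ t ∈ Ici (0 : ℝ), HasDerivAt (fun t => -H (Real.exp (-t)))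
        (Real.exp (-t) * g (Real.exp (-t))) t := by
      intro t ht
      have ht' : 0 ≤ t := ht
      have h1 : HasDerivAt (fun t : ℝ => Real.exp (-t)) (-Real.exp (-t)) t := by
        simpa using (hasDerivAt_neg t).exp
      have h2 := ((hH (Real.exp (-t)) ⟨(Real.exp_pos _).le, by simpa using ht'⟩).comp t h1).neg
      refine h2.congr_deriv ?_
      ring
    have hintegral : IntegrableOn (fun t => Real.exp (-t) * g (Real.exp (-t))) (Ioi (0 : ℝ)) := by
      refine hbi.mono' (hgexp.aestronglyMeasurable measurableSet_Ioi) ?_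
      refine (ae_restrict_iff' measurableSet_Ioi).mpr (Eventually.of_forall fun t ht => ?_)
      have ht' : 0 < t := ht
      refine (hgb t ht).trans (mul_le_mul_of_nonneg_left ?_ hCnn)
      nlinarith [Real.exp_pos (-t)]
    have hT : Tendsto (fun t : ℝ => -H (Real.exp (-t))) atTop (𝓝 (-H 0)) :=
      ((hH 0 (by simp)).continuousAt.tendsto.comp
        (Real.tendsto_exp_neg_atTop_nhds_zero)).neg
    rw [integral_Ioi_of_hasDerivAt_of_tendsto' hd hintegral hT]
    simp
    ring
  rw [hval] at hlim
  have hG : Tendsto Real.Gamma (𝓝[>] 1) (𝓝 1) := by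
    have := (Real.differentiableAt_Gamma (s := 1) (fun m => by
      have : (0 : ℝ) ≤ m := by positivity
      linarith)).continuousAt.tendsto
    rw [Real.Gamma_one] at this
    exact this.mono_left nhdsWithin_le_nhds
  have := hlim.div hG one_ne_zero
  rw [div_one] at this
  refine this.congr' ?_
  filter_upwards [self_mem_nhdsWithin] with s hs
  have hs : 1 < s := hs
  rw [Pi.div_apply, ← gamma_mul_dirichletSeries hf hg hs,
    mul_div_cancel_left₀ _ (Real.Gamma_pos_of_pos (by linarith)).ne']

/-- The generating function of a periodic sequence. -/
theorem hasSum_periodic {f : ℕ → ℝ} {N : ℕ} (hN : 0 < N) (hper : ∀ n, f (n + N) = f n)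
    {C : ℝ} (hf : ∀ n, |f n| ≤ C) {x : ℝ} (hx : x ∈ Ioo (0 : ℝ) 1) :
    HasSum (fun n => f n * x ^ n) ((∑ n ∈ Finset.range N, f n * x ^ n) / (1 - x ^ N)) := by
  have hs : Summable fun n => f n * x ^ n := by
    refine Summable.of_norm_bounded ((summable_geometric_of_lt_one hx.1.le hx.2).mul_left C) ?_
    intro n
    rw [norm_mul, Real.norm_eq_abs, Real.norm_of_nonneg (pow_nonneg hx.1.le n)]
    exact mul_le_mul_of_nonneg_right (hf n) (pow_nonneg hx.1.le n)
  have h1 := hs.sum_add_tsum_nat_add N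
  have h2 : ∑' n, f (n + N) * x ^ (n + N) = x ^ N * ∑' n, f n * x ^ n := by
    rw [← tsum_mul_left]
    refine tsum_congr fun n => ?_
    rw [hper, pow_add]
    ring
  rw [h2] at h1
  have h3 : x ^ N < 1 := pow_lt_one₀ hx.1.le hx.2 hN.ne'
  have : (∑ n ∈ Finset.range N, f n * x ^ n) / (1 - x ^ N) = ∑' n, f n * x ^ n := by
    rw [div_eq_iff (by linarith)]
    linarith
  rw [this]
  exact hs.hasSum

end DirichletLimit

section LValues

open Set Topology

theorem abs_chi29_le (n : ℕ) : |(chi29 n : ℝ)| ≤ 1 := by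
  rcases jacobiSym.trichotomy (n : ℤ) 29 with h | h | h <;> simp [chi29, h]

theorem abs_chiNegEight_le (n : ℕ) : |(chiNegEight n : ℝ)| ≤ 1 := by
  have : ∀ a : ZMod 8, |ZMod.χ₈' a| ≤ 1 := by decide
  have := this n
  rw [chiNegEight]
  exact_mod_cast this

theorem chi29_add (n : ℕ) : chi29 (n + 29) = chi29 n := by
  rw [chi29, chi29, jacobiSym.mod_left]
  conv_rhs => rw [jacobiSym.mod_left]
  simp

theorem chiNegEight_add (n : ℕ) : chiNegEight (n + 8) = chiNegEight n := by
  simp only [chiNegEight, Nat.cast_add]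
  rw [show ((8 : ℕ) : ZMod 8) = 0 from rfl, add_zero]

/-- The polynomial `U` with `U ^ 2 - 29 * V ^ 2 = 4 * Φ₂₉`, where `V` is `surdHalf29`. -/
noncomputable def traceHalf29 : Polynomial ℝ :=
  open Polynomial in
  2 + X + 8 * X ^ 2 - 3 * X ^ 3 + X ^ 4 - 2 * X ^ 5 + 3 * X ^ 6 + 9 * X ^ 7 + 3 * X ^ 8
    - 2 * X ^ 9 + X ^ 10 - 3 * X ^ 11 + 8 * X ^ 12 + X ^ 13 + 2 * X ^ 14

/-- The polynomial `V` with `U ^ 2 - 29 * V ^ 2 = 4 * Φ₂₉`, where `U` is `traceHalf29`. -/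
noncomputable def surdHalf29 : Polynomial ℝ :=
  open Polynomial in
  -X - X ^ 3 + X ^ 4 - X ^ 6 - X ^ 7 - X ^ 8 + X ^ 10 - X ^ 11 - X ^ 13

theorem traceHalf29_sq_sub (x : ℝ) :
    traceHalf29.eval x ^ 2 - 29 * surdHalf29.eval x ^ 2 = 4 * ∑ n ∈ Finset.range 29, x ^ n := by
  simp only [traceHalf29, surdHalf29, Polynomial.eval_add, Polynomial.eval_sub,
    Polynomial.eval_mul, Polynomial.eval_pow, Polynomial.eval_X, Polynomial.eval_ofNat,
    Polynomial.eval_neg, Finset.sum_range_succ, Finset.sum_range_zero]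
  ring

theorem wronskian_half29 (x : ℝ) :
    (traceHalf29.derivative.eval x * surdHalf29.eval x -
      traceHalf29.eval x * surdHalf29.derivative.eval x) * (1 - x) =
      2 * ∑ n ∈ Finset.range 29, (chi29 (n + 1) : ℝ) * x ^ n := by
  simp only [Finset.sum_range_succ, Finset.sum_range_zero]
  norm_num [chi29]
  simp [traceHalf29, surdHalf29]
  ring

theorem tendsto_dirichletSeries_chi29 :
    Tendsto (fun s : ℝ => ∑' n : ℕ, (chi29 (n + 1) : ℝ) * ((n : ℝ) + 1) ^ (-s)) (𝓝[>] 1)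
      (𝓝 (2 * Real.log ((5 + √29) / 2) / √29)) := by
  set w := √29 with hw
  have hw2 : w ^ 2 = 29 := Real.sq_sqrt (by norm_num)
  have hwpos : 0 < w := Real.sqrt_pos.mpr (by norm_num)
  set U := traceHalf29
  set V := surdHalf29
  set Φ : ℝ → ℝ := fun x => ∑ n ∈ Finset.range 29, x ^ n with hΦ
  have hΦpos : ∀ x ∈ Icc (0 : ℝ) 1, 0 < Φ x := fun x hx => by
    rw [hΦ]
    simp only [Finset.sum_range_succ']
    have := hx.1
    positivity
  have hprod : ∀ x, (U.eval x - w * V.eval x) * (U.eval x + w * V.eval x) = 4 * Φ x := fun x => by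
    rw [hΦ, ← traceHalf29_sq_sub x]
    linear_combination (-V.eval x ^ 2) * hw2
  have hlim := tendsto_dirichletSeries (f := fun n => (chi29 (n + 1) : ℝ))
    (g := fun x => (U.derivative.eval x * V.eval x - U.eval x * V.derivative.eval x) / (2 * Φ x))
    (H := fun x => (Real.log (U.eval x - w * V.eval x) - Real.log (U.eval x + w * V.eval x)) / w)
    (fun n => abs_chi29_le _) ?_ ?_ ?_
  · have hval : (Real.log (U.eval 1 - w * V.eval 1) - Real.log (U.eval 1 + w * V.eval 1)) / w -
        (Real.log (U.eval 0 - w * V.eval 0) - Real.log (U.eval 0 + w * V.eval 0)) / w =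
        2 * Real.log ((5 + w) / 2) / w := by
      have hU1 : U.eval 1 = 29 := by simp [U, traceHalf29]; norm_num
      have hV1 : V.eval 1 = -5 := by simp [V, surdHalf29]; norm_num
      have hU0 : U.eval 0 = 2 := by simp [U, traceHalf29]
      have hV0 : V.eval 0 = 0 := by simp [V, surdHalf29]
      have hlt : w < 5.4 := by nlinarith
      rw [hU1, hV1, hU0, hV0, ← Real.log_div (by nlinarith) (by nlinarith)]
      have : (29 - w * -5) / (29 + w * -5) = ((5 + w) / 2) ^ 2 := by
        rw [div_eq_iff (by nlinarith)]
        linear_combination (5 / 4 * w + 21 / 4) * hw2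
      rw [this, Real.log_pow]
      simp
    rw [← hval]
    exact hlim
  · intro x hx
    have hx1 : x < 1 := hx.2
    have := hasSum_periodic (f := fun n => (chi29 (n + 1) : ℝ)) (N := 29) (by norm_num)
      (fun n => by rw [show n + 29 + 1 = n + 1 + 29 by ring, chi29_add]) (fun n => abs_chi29_le _) hx
    convert this using 1
    have hg : Φ x * (1 - x) = 1 - x ^ 29 := by
      have := geom_sum_mul x 29
      rw [hΦ]
      linear_combination -this
    have h1 : 0 < 1 - x := by linarith
    have := hΦpos x ⟨hx.1.le, hx.2.le⟩
    rw [← hg, div_eq_div_iff (by positivity) (by positivity)]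
    linear_combination Φ x * wronskian_half29 x
  · refine ContinuousOn.div (by fun_prop) (by fun_prop) fun x hx => ?_
    have := hΦpos x hx
    positivity
  · intro x hx
    have hpos := hΦpos x hx
    have hne := hprod x
    have h4 : (U.eval x - w * V.eval x) * (U.eval x + w * V.eval x) ≠ 0 := by
      rw [hne]; positivity
    have hB := left_ne_zero_of_mul h4
    have hA := right_ne_zero_of_mul h4
    have hdU := U.hasDerivAt x
    have hdV := (V.hasDerivAt x).const_mul w
    refine ((((hdU.sub hdV).log hB).sub ((hdU.add hdV).log hA)).div_const w).congr_deriv ?_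
    have hΦx : Φ x = (U.eval x - w * V.eval x) * (U.eval x + w * V.eval x) / 4 := by
      rw [hne]; ring
    rw [hΦx, Pi.sub_apply, Pi.add_apply]
    field_simp
    ring

theorem tendsto_dirichletSeries_chiNegEight :
    Tendsto (fun s : ℝ => ∑' n : ℕ, (chiNegEight (n + 1) : ℝ) * ((n : ℝ) + 1) ^ (-s)) (𝓝[>] 1)
      (𝓝 (π / (2 * √2))) := by
  set w := √2 with hw
  have hw2 : w ^ 2 = 2 := Real.sq_sqrt (by norm_num)
  have hwpos : 0 < w := Real.sqrt_pos.mpr (by norm_num)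
  have hlim := tendsto_dirichletSeries (f := fun n => (chiNegEight (n + 1) : ℝ))
    (g := fun x => (1 + x ^ 2) / (1 + x ^ 4))
    (H := fun x => (Real.arctan (w * x + 1) + Real.arctan (w * x - 1)) / w)
    (fun n => abs_chiNegEight_le _) ?_ ?_ ?_
  · have hval : (Real.arctan (w * 1 + 1) + Real.arctan (w * 1 - 1)) / w -
        (Real.arctan (w * 0 + 1) + Real.arctan (w * 0 - 1)) / w = π / (2 * w) := by
      have hinv : w * 1 - 1 = (w * 1 + 1)⁻¹ := by
        refine eq_inv_of_mul_eq_one_left ?_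
        linear_combination hw2
      rw [hinv, Real.arctan_inv_of_pos (by positivity)]
      simp only [mul_zero, zero_add, zero_sub, Real.arctan_neg]
      field_simp
      ring
    rw [← hval]
    exact hlim
  · intro x hx
    have := hasSum_periodic (f := fun n => (chiNegEight (n + 1) : ℝ)) (N := 8) (by norm_num)
      (fun n => by rw [show n + 8 + 1 = n + 1 + 8 by ring, chiNegEight_add])
      (fun n => abs_chiNegEight_le _) hx
    convert this using 1
    have h1 : chiNegEight 1 = 1 := by decide
    have h2 : chiNegEight 2 = 0 := by decide
    have h3 : chiNegEight 3 = 1 := by decide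
    have h4 : chiNegEight 4 = 0 := by decide
    have h5 : chiNegEight 5 = -1 := by decide
    have h6 : chiNegEight 6 = 0 := by decide
    have h7 : chiNegEight 7 = -1 := by decide
    have h8 : chiNegEight 8 = 0 := by decide
    have hlt : x ^ 8 < 1 := pow_lt_one₀ hx.1.le hx.2 (by norm_num)
    have hlt' : 0 < 1 - x ^ 8 := by linarith
    simp only [Finset.sum_range_succ, Finset.sum_range_zero, zero_add, Nat.reduceAdd, h1, h2, h3,
      h4, h5, h6, h7, h8]
    rw [div_eq_div_iff (by positivity) hlt'.ne']
    push_cast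
    ring
  · exact ContinuousOn.div (by fun_prop) (by fun_prop) fun x hx => by positivity
  · intro x hx
    have hd : HasDerivAt (fun x : ℝ => w * x) w x := by
      simpa using (hasDerivAt_id x).const_mul w
    refine ((((hd.add_const 1).arctan).add ((hd.sub_const 1).arctan)).div_const w).congr_deriv ?_
    have h1 : (1 + (w * x + 1) ^ 2) * (1 + (w * x - 1) ^ 2) = 4 * (1 + x ^ 4) := by
      linear_combination (w ^ 2 * x ^ 4 + 2 * x ^ 4) * hw2
    have h2 : (1 + (w * x + 1) ^ 2) + (1 + (w * x - 1) ^ 2) = 4 * (1 + x ^ 2) := by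
      linear_combination (2 * x ^ 2) * hw2
    have h3 : 0 < 1 + x ^ 4 := by positivity
    rw [div_eq_iff hwpos.ne']
    field_simp
    linear_combination (1 + x ^ 4) * h2 - (1 + x ^ 2) * h1

end LValues

section FormSeries

open Set Topology

theorem summable_form {a b : ℝ} (ha : 1 ≤ a) (hb : 1 ≤ b) {s : ℝ} (hs : 1 < s) :
    Summable fun v : ℤ × ℤ => (a * (v.1 : ℝ) ^ 2 + b * (v.2 : ℝ) ^ 2) ^ (-s) := by
  have h := EisensteinSeries.summable_one_div_norm_rpow (k := 2 * s) (by linarith)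
  rw [← (finTwoArrowEquiv ℤ).symm.summable_iff] at h
  refine h.of_nonneg_of_le (fun v => by positivity) fun v => ?_
  rcases eq_or_ne v 0 with rfl | hv
  · simp [Real.zero_rpow (show -s ≠ 0 by linarith)]
    positivity
  have hv' : (finTwoArrowEquiv ℤ).symm v ≠ 0 := fun h0 => hv (by
    have := congrArg (finTwoArrowEquiv ℤ) h0
    simpa [Prod.ext_iff] using this)
  have hn := norm_pos_iff.mpr hv'
  rw [Function.comp_apply, show -(2 * s) = 2 * -s by ring, Real.rpow_mul hn.le, Real.rpow_two]
  refine Real.rpow_le_rpow_of_nonpos (by positivity) ?_ (by linarith)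
  set N := ‖(finTwoArrowEquiv ℤ).symm v‖ with hN
  have hle : N ≤ √((v.1 : ℝ) ^ 2 + (v.2 : ℝ) ^ 2) := by
    rw [hN, pi_norm_le_iff_of_nonneg (Real.sqrt_nonneg _)]
    intro i
    fin_cases i
    · simp only [finTwoArrowEquiv_symm_apply, Fin.zero_eta, Matrix.cons_val_zero, Int.norm_eq_abs]
      exact Real.abs_le_sqrt (by nlinarith)
    · simp only [finTwoArrowEquiv_symm_apply, Fin.mk_one, Matrix.cons_val_one, Matrix.cons_val_fin_one,
        Int.norm_eq_abs]
      exact Real.abs_le_sqrt (by nlinarith)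
  have := (Real.le_sqrt hn.le (by positivity)).mp hle
  nlinarith [sq_nonneg (v.1 : ℝ), sq_nonneg (v.2 : ℝ)]

theorem hasSum_form {a b : ℕ} (ha : 0 < a) (hb : 0 < b) {s : ℝ} (hs : 1 < s) :
    HasSum (fun n : ℕ => ({v : ℤ × ℤ | a * v.1 ^ 2 + b * v.2 ^ 2 = n}.ncard : ℝ) * (n : ℝ) ^ (-s))
      (∑' v : ℤ × ℤ, ((a : ℝ) * (v.1 : ℝ) ^ 2 + b * (v.2 : ℝ) ^ 2) ^ (-s)) := by
  have h := (summable_form (a := a) (b := b) (by exact_mod_cast ha) (by exact_mod_cast hb)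
    hs).hasSum.tsum_fiberwise (fun v : ℤ × ℤ => (a * v.1 ^ 2 + b * v.2 ^ 2).toNat)
  refine h.congr_fun fun n => ?_
  have hset : (fun v : ℤ × ℤ => (a * v.1 ^ 2 + b * v.2 ^ 2).toNat) ⁻¹' {n} =
      {v : ℤ × ℤ | a * v.1 ^ 2 + b * v.2 ^ 2 = n} := by
    ext v
    have : (0 : ℤ) ≤ a * v.1 ^ 2 + b * v.2 ^ 2 := by positivity
    simp only [mem_preimage, mem_singleton_iff, Set.mem_ofPred_eq]
    omega
  rw [hset]
  have hconst : ∀ v : {v : ℤ × ℤ | a * v.1 ^ 2 + b * v.2 ^ 2 = n},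
      ((a : ℝ) * ((v : ℤ × ℤ).1 : ℝ) ^ 2 + b * ((v : ℤ × ℤ).2 : ℝ) ^ 2) ^ (-s) =
        (n : ℝ) ^ (-s) := fun v => by
    have : (a * (v : ℤ × ℤ).1 ^ 2 + b * (v : ℤ × ℤ).2 ^ 2 : ℤ) = n := v.2
    rw [show ((a : ℝ) * ((v : ℤ × ℤ).1 : ℝ) ^ 2 + b * ((v : ℤ × ℤ).2 : ℝ) ^ 2) = (n : ℝ) by
      exact_mod_cast this]
  rw [tsum_congr hconst, tsum_const, nsmul_eq_mul, Nat.card_coe_set_eq]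

theorem ncard_two_twentynine (n : ℕ) :
    {v : ℤ × ℤ | (2 : ℕ) * v.1 ^ 2 + (29 : ℕ) * v.2 ^ 2 = n}.ncard = (repSet (2 * n)).ncard := by
  rw [← ncard_image_of_injective (f := fun v : ℤ × ℤ => (2 * v.1, v.2))]
  · congr 1
    ext ⟨x, y⟩
    simp only [mem_image, Set.mem_ofPred_eq, repSet, Prod.exists, Prod.mk.injEq,
      exists_eq_right_right]
    push_cast
    constructor
    · rintro ⟨x, h, rfl⟩
      linear_combination 2 * h
    · intro h
      have h2 : (2 : ℤ) ∣ x ^ 2 := ⟨n - 29 * y ^ 2, by linear_combination h⟩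
      obtain ⟨t, rfl⟩ := Int.prime_two.dvd_of_dvd_pow h2
      exact ⟨t, by linarith, rfl⟩
  · rintro ⟨x, y⟩ ⟨z, w⟩ h
    simp only [Prod.mk.injEq] at h ⊢
    omega

theorem hasSum_repDiff {s : ℝ} (hs : 1 < s) :
    HasSum (fun n : ℕ => (repDiff n : ℝ) * (n : ℝ) ^ (-s))
      ((∑' v : ℤ × ℤ, ((v.1 : ℝ) ^ 2 + 58 * (v.2 : ℝ) ^ 2) ^ (-s)) -
        ∑' v : ℤ × ℤ, (2 * (v.1 : ℝ) ^ 2 + 29 * (v.2 : ℝ) ^ 2) ^ (-s)) := by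
  have h := (hasSum_form (a := 1) (b := 58) (by norm_num) (by norm_num) hs).sub
    (hasSum_form (a := 2) (b := 29) (by norm_num) (by norm_num) hs)
  simp only [ncard_two_twentynine, ← sub_mul] at h
  simp only [Nat.cast_one, one_mul, Nat.cast_ofNat] at h
  refine h.congr_fun fun n => ?_
  simp [repDiff, repSet]

theorem summable_mul_rpow {f : ℕ → ℤ} (hf : ∀ n, |(f n : ℝ)| ≤ 1) {s : ℝ} (hs : 1 < s) :
    Summable fun n : ℕ => ‖(f n : ℝ) * (n : ℝ) ^ (-s)‖ := by
  refine (Real.summable_nat_rpow.mpr (show -s < -1 by linarith)).of_nonneg_of_le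
    (fun n => norm_nonneg _) fun n => ?_
  rw [norm_mul, Real.norm_eq_abs, Real.norm_of_nonneg (by positivity)]
  exact mul_le_of_le_one_left (by positivity) (hf n)

theorem hasSum_dirConv {f g : ℕ → ℤ} (hf : ∀ n, |(f n : ℝ)| ≤ 1) (hg : ∀ n, |(g n : ℝ)| ≤ 1)
    {s : ℝ} (hs : 1 < s) :
    HasSum (fun n : ℕ => (dirConv f g n : ℝ) * (n : ℝ) ^ (-s))
      ((∑' n : ℕ, (f n : ℝ) * (n : ℝ) ^ (-s)) * ∑' n : ℕ, (g n : ℝ) * (n : ℝ) ^ (-s)) := by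
  have hF := summable_mul_rpow hf hs
  have hG := summable_mul_rpow hg hs
  rw [tsum_mul_tsum_of_summable_norm hF hG]
  have h := (summable_mul_of_summable_norm hF hG).hasSum.tsum_fiberwise
    (fun p : ℕ × ℕ => p.1 * p.2)
  refine h.congr_fun fun n => ?_
  have hz : (0 : ℝ) ^ (-s) = 0 := Real.zero_rpow (by linarith)
  rcases eq_or_ne n 0 with rfl | hn
  · rw [Nat.cast_zero, hz, mul_zero]
    symm
    refine (tsum_congr fun p => ?_).trans tsum_zero
    have hp : (p : ℕ × ℕ).1 * (p : ℕ × ℕ).2 = 0 := p.2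
    rcases Nat.mul_eq_zero.mp hp with h0 | h0 <;> simp [h0, hz]
  · have hset : (fun p : ℕ × ℕ => p.1 * p.2) ⁻¹' {n} = ↑n.divisorsAntidiagonal := by
      ext p
      simp [hn]
    rw [hset, Finset.tsum_subtype' n.divisorsAntidiagonal (fun p : ℕ × ℕ =>
      (f p.1 : ℝ) * (p.1 : ℝ) ^ (-s) * ((g p.2 : ℝ) * (p.2 : ℝ) ^ (-s))), dirConv]
    push_cast
    rw [Finset.sum_mul]
    refine Finset.sum_congr rfl fun p hp => ?_
    rw [← (Nat.mem_divisorsAntidiagonal.mp hp).1, Nat.cast_mul,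
      Real.mul_rpow (by positivity) (by positivity)]
    ring

theorem tsum_eq_tsum_succ {f : ℕ → ℤ} (hf : ∀ n, |(f n : ℝ)| ≤ 1) {s : ℝ} (hs : 1 < s) :
    ∑' n : ℕ, (f n : ℝ) * (n : ℝ) ^ (-s) =
      ∑' n : ℕ, (f (n + 1) : ℝ) * ((n : ℝ) + 1) ^ (-s) := by
  rw [(summable_mul_rpow hf hs).of_norm.tsum_eq_zero_add]
  simp [Real.zero_rpow (show -s ≠ 0 by linarith)]

/-- The genus-theoretic factorisation of the difference of two Epstein zeta functions, in the
limit `s → 1⁺`. -/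
theorem tendsto_form_diff :
    Tendsto (fun s : ℝ => (∑' v : ℤ × ℤ, ((v.1 : ℝ) ^ 2 + 58 * (v.2 : ℝ) ^ 2) ^ (-s)) -
        ∑' v : ℤ × ℤ, (2 * (v.1 : ℝ) ^ 2 + 29 * (v.2 : ℝ) ^ 2) ^ (-s)) (𝓝[>] 1)
      (𝓝 (2 * ((2 * Real.log ((5 + √29) / 2) / √29) * (π / (2 * √2))))) := by
  refine ((tendsto_dirichletSeries_chi29.mul tendsto_dirichletSeries_chiNegEight).const_mul
    2).congr' ?_
  filter_upwards [self_mem_nhdsWithin] with s hs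
  have hs : 1 < s := hs
  rw [← tsum_eq_tsum_succ abs_chi29_le hs, ← tsum_eq_tsum_succ abs_chiNegEight_le hs]
  have h := (hasSum_dirConv abs_chi29_le abs_chiNegEight_le hs).mul_left 2
  refine h.unique ((hasSum_repDiff hs).congr_fun fun n => ?_)
  rcases eq_or_ne n 0 with rfl | hn
  · simp [Real.zero_rpow (show -s ≠ 0 by linarith)]
  · rw [repDiff_eq n hn]
    push_cast
    ring

end FormSeries

section RowSums

open Set Topology MeasureTheory

theorem hasSum_int_of_even {f : ℤ → ℝ} (hf : ∀ n, f (-n) = f n)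
    (hs : Summable fun n : ℕ => f n) : HasSum f (f 0 + 2 * ∑' n : ℕ, f (n + 1)) := by
  have h1 : HasSum (fun n : ℕ => f (n + 1)) (∑' n : ℕ, f (n + 1)) := by
    have := (summable_nat_add_iff 1).mpr hs
    push_cast at this
    exact this.hasSum
  have h2 : HasSum (fun n : ℕ => f (-(n + 1))) (∑' n : ℕ, f (n + 1)) := by
    simpa only [hf] using h1
  convert h1.of_add_one_of_neg_add_one h2 using 1
  ring

/-- The sum `∑ (x² + a²)^(-s)` over the integers. -/
noncomputable def rowSum (a s : ℝ) : ℝ := ∑' x : ℤ, ((x : ℝ) ^ 2 + a ^ 2) ^ (-s)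

/-- The integral `∫ (1 + t²)^(-s)` over the positive half-line. -/
noncomputable def halfBeta (s : ℝ) : ℝ := ∫ t in Ioi (0 : ℝ), (1 + t ^ 2) ^ (-s)

/-- The error term in replacing `rowSum` by the corresponding integral. -/
noncomputable def rowError (a s : ℝ) : ℝ := rowSum a s - 2 * a ^ (1 - 2 * s) * halfBeta s

theorem one_add_sq_rpow_le {s : ℝ} (hs : 1 ≤ s) (t : ℝ) :
    (1 + t ^ 2) ^ (-s) ≤ (1 + t ^ 2)⁻¹ := by
  rw [← Real.rpow_neg_one]
  exact Real.rpow_le_rpow_of_exponent_le (by nlinarith) (by linarith)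

theorem continuous_one_add_sq_rpow (s : ℝ) : Continuous fun t : ℝ => (1 + t ^ 2) ^ (-s) :=
  (by fun_prop : Continuous fun t : ℝ => 1 + t ^ 2).rpow_const fun t =>
    Or.inl (by positivity)

theorem integrable_one_add_sq_rpow {s : ℝ} (hs : 1 ≤ s) :
    Integrable fun t : ℝ => (1 + t ^ 2) ^ (-s) := by
  refine integrable_inv_one_add_sq.mono' (continuous_one_add_sq_rpow s).aestronglyMeasurable ?_
  refine Eventually.of_forall fun t => ?_
  rw [Real.norm_of_nonneg (by positivity)]
  exact one_add_sq_rpow_le hs t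

theorem halfBeta_one : halfBeta 1 = π / 2 := by
  simp [halfBeta, Real.rpow_neg_one]

theorem tendsto_halfBeta : Tendsto halfBeta (𝓝[>] 1) (𝓝 (π / 2)) := by
  rw [← halfBeta_one]
  refine tendsto_integral_filter_of_dominated_convergence (fun t => (1 + t ^ 2)⁻¹)
    (Eventually.of_forall fun s => (continuous_one_add_sq_rpow s).aestronglyMeasurable) ?_
    integrable_inv_one_add_sq.integrableOn ?_
  · filter_upwards [self_mem_nhdsWithin] with s hs
    refine Eventually.of_forall fun t => ?_
    rw [Real.norm_of_nonneg (by positivity)]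
    exact one_add_sq_rpow_le (le_of_lt hs) t
  · refine Eventually.of_forall fun t => ?_
    have : Continuous fun s : ℝ => (1 + t ^ 2) ^ (-s) :=
      (Real.continuous_const_rpow (by positivity)).comp continuous_neg
    exact this.continuousAt.mono_left nhdsWithin_le_nhds

theorem sq_add_sq_rpow {a : ℝ} (ha : 0 < a) (s t : ℝ) :
    ((a * t) ^ 2 + a ^ 2) ^ (-s) = a ^ (-(2 * s)) * (1 + t ^ 2) ^ (-s) := by
  rw [show (a * t) ^ 2 + a ^ 2 = a ^ 2 * (1 + t ^ 2) by ring,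
    Real.mul_rpow (by positivity) (by positivity), show -(2 * s) = 2 * -s by ring,
    Real.rpow_mul ha.le, Real.rpow_two]

theorem integral_sq_add_sq_rpow {a : ℝ} (ha : 0 < a) (s : ℝ) :
    ∫ t in Ioi (0 : ℝ), (t ^ 2 + a ^ 2) ^ (-s) = a ^ (1 - 2 * s) * halfBeta s := by
  have h := integral_comp_mul_left_Ioi (fun t : ℝ => (t ^ 2 + a ^ 2) ^ (-s)) 0 ha
  simp only [sq_add_sq_rpow ha, mul_zero, integral_const_mul, smul_eq_mul] at h
  rw [eq_inv_mul_iff_mul_eq₀ ha.ne'] at h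
  rw [← h, halfBeta, show 1 - 2 * s = 1 + -(2 * s) by ring, Real.rpow_add ha, Real.rpow_one]
  ring

theorem integrableOn_sq_add_sq_rpow {a : ℝ} (ha : 0 < a) {s : ℝ} (hs : 1 ≤ s) :
    IntegrableOn (fun t : ℝ => (t ^ 2 + a ^ 2) ^ (-s)) (Ioi 0) := by
  have h := ((integrable_one_add_sq_rpow hs).const_mul (a ^ (-(2 * s)))).comp_mul_left'
    (inv_ne_zero ha.ne')
  refine (h.congr (Eventually.of_forall fun t => ?_)).integrableOn
  change a ^ (-(2 * s)) * (1 + (a⁻¹ * t) ^ 2) ^ (-s) = _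
  rw [← sq_add_sq_rpow ha, mul_inv_cancel_left₀ ha.ne']

theorem antitoneOn_sq_add_sq_rpow {a : ℝ} (ha : 0 < a) {s : ℝ} (hs : 1 ≤ s) :
    AntitoneOn (fun t : ℝ => (t ^ 2 + a ^ 2) ^ (-s)) (Ici 0) := by
  intro t ht u hu htu
  have ht : 0 ≤ t := ht
  refine Real.rpow_le_rpow_of_nonpos (by positivity) ?_ (by linarith)
  gcongr

theorem summable_sq_add_sq_rpow {a : ℝ} (ha : 0 < a) {s : ℝ} (hs : 1 ≤ s) :
    Summable fun n : ℕ => ((n : ℝ) ^ 2 + a ^ 2) ^ (-s) :=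
  (antitoneOn_sq_add_sq_rpow ha hs).summable_of_integrableOn_Ioi_zero
    (integrableOn_sq_add_sq_rpow ha hs) fun t _ => by positivity

theorem hasSum_rowSum {a : ℝ} (ha : 0 < a) {s : ℝ} (hs : 1 ≤ s) :
    HasSum (fun x : ℤ => ((x : ℝ) ^ 2 + a ^ 2) ^ (-s))
      (a ^ (-(2 * s)) + 2 * ∑' n : ℕ, (((n : ℝ) + 1) ^ 2 + a ^ 2) ^ (-s)) := by
  have h := hasSum_int_of_even (f := fun x : ℤ => ((x : ℝ) ^ 2 + a ^ 2) ^ (-s))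
    (fun n => by simp) (by simpa using summable_sq_add_sq_rpow ha hs)
  have h0 : (((0 : ℤ) : ℝ) ^ 2 + a ^ 2) ^ (-s) = a ^ (-(2 * s)) := by
    simpa using sq_add_sq_rpow ha s 0
  rw [h0] at h
  simpa using h

theorem rowSum_eq {a : ℝ} (ha : 0 < a) {s : ℝ} (hs : 1 ≤ s) :
    rowSum a s = a ^ (-(2 * s)) + 2 * ∑' n : ℕ, (((n : ℝ) + 1) ^ 2 + a ^ 2) ^ (-s) :=
  (hasSum_rowSum ha hs).tsum_eq

theorem abs_rowError_le {a : ℝ} (ha : 0 < a) {s : ℝ} (hs : 1 ≤ s) :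
    |rowError a s| ≤ a ^ (-(2 * s)) := by
  have hanti := antitoneOn_sq_add_sq_rpow ha hs
  have hintegral := integrableOn_sq_add_sq_rpow ha hs
  have hsum := summable_sq_add_sq_rpow ha hs
  have h1 := hanti.tsum_add_one_le_integral hintegral fun t _ => by positivity
  have h2 := hanti.integral_le_tsum hsum fun t _ => by positivity
  have h0 : (((0 : ℕ) : ℝ) ^ 2 + a ^ 2) ^ (-s) = a ^ (-(2 * s)) := by
    simpa using sq_add_sq_rpow ha s 0
  rw [hsum.tsum_eq_zero_add, h0] at h2
  rw [integral_sq_add_sq_rpow ha] at h1 h2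
  push_cast at h1 h2
  rw [rowError, rowSum_eq ha hs, abs_le]
  constructor <;> linarith

theorem tendsto_rowSum {a : ℝ} (ha : 1 ≤ a) : Tendsto (rowSum a) (𝓝[>] 1) (𝓝 (rowSum a 1)) := by
  have ha0 : 0 < a := by linarith
  refine tendsto_tsum_of_dominated_convergence 
    (bound := fun x : ℤ => ((x : ℝ) ^ 2 + a ^ 2) ^ (-1 : ℝ)) (hasSum_rowSum ha0 le_rfl).summable ?_ ?_
  · intro x
    have : Continuous fun s : ℝ => ((x : ℝ) ^ 2 + a ^ 2) ^ (-s) :=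
      (Real.continuous_const_rpow (by positivity)).comp continuous_neg
    exact this.continuousAt.mono_left nhdsWithin_le_nhds
  · filter_upwards [self_mem_nhdsWithin] with s hs x
    have hs : 1 < s := hs
    rw [Real.norm_of_nonneg (by positivity)]
    exact Real.rpow_le_rpow_of_exponent_le (by nlinarith [sq_nonneg (x : ℝ)]) (by linarith)

theorem tendsto_rowError {a : ℝ} (ha : 1 ≤ a) :
    Tendsto (rowError a) (𝓝[>] 1) (𝓝 (rowError a 1)) := by
  have ha0 : 0 < a := by linarith
  have h1 : Tendsto (fun s : ℝ => a ^ (1 - 2 * s)) (𝓝[>] 1) (𝓝 (a ^ ((1 : ℝ) - 2 * 1))) := by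
    have : Continuous fun s : ℝ => a ^ (1 - 2 * s) :=
      (Real.continuous_const_rpow ha0.ne').comp (by fun_prop)
    exact this.continuousAt.mono_left nhdsWithin_le_nhds
  have h2 := tendsto_halfBeta
  rw [← halfBeta_one] at h2
  exact (tendsto_rowSum ha).sub ((h1.const_mul 2).mul h2)

theorem rowSum_one {a : ℝ} (ha : 0 < a) :
    rowSum a 1 = π / a * (1 + 2 / (Real.exp (2 * π * a) - 1)) := by
  have hz : (a * Complex.I : ℂ) ∈ Complex.integerComplement := by
    refine UpperHalfPlane.coe_mem_integerComplement ⟨a * Complex.I, by simpa using ha⟩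
  have h := cot_series_rep' hz
  have hterm : ∀ n : ℕ, (1 / ((a * Complex.I : ℂ) - (n + 1)) + 1 / ((a * Complex.I : ℂ) + (n + 1))) =
      ((-2 * a * (((n : ℝ) + 1) ^ 2 + a ^ 2) ^ (-1 : ℝ) : ℝ) : ℂ) * Complex.I := fun n => by
    have h1 : (a * Complex.I : ℂ) - (n + 1) ≠ 0 := fun h0 => by
      have := congrArg Complex.im h0
      simp at this
      exact ha.ne' this
    have h2 : (a * Complex.I : ℂ) + (n + 1) ≠ 0 := fun h0 => by
      have := congrArg Complex.im h0
      simp at this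
      exact ha.ne' this
    have h3 : ((n : ℂ) + 1) ^ 2 + (a : ℂ) ^ 2 ≠ 0 := by
      have : (0 : ℝ) < ((n : ℝ) + 1) ^ 2 + a ^ 2 := by positivity
      exact_mod_cast this.ne'
    rw [Real.rpow_neg_one]
    push_cast
    field_simp
    linear_combination (2 * a ^ 3 * Complex.I) * Complex.I_sq
  rw [tsum_congr hterm, tsum_mul_right, ← Complex.ofReal_tsum, tsum_mul_left] at h
  set T := ∑' n : ℕ, (((n : ℝ) + 1) ^ 2 + a ^ 2) ^ (-1 : ℝ) with hT
  rw [rowSum_eq ha le_rfl, ← hT]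
  have hne : Real.exp (2 * π * a) - 1 ≠ 0 := by
    have := Real.add_one_lt_exp (show 2 * π * a ≠ 0 by positivity)
    have : 0 < 2 * π * a := by positivity
    linarith
  have hcot : Complex.cot (π * (a * Complex.I)) =
      ((-(1 + 2 / (Real.exp (2 * π * a) - 1)) : ℝ) : ℂ) * Complex.I := by
    rw [Complex.cot_eq_exp_ratio]
    rw [show 2 * Complex.I * (π * (a * Complex.I)) = ((-(2 * π * a) : ℝ) : ℂ) by
      push_cast; linear_combination (2 * π * a : ℂ) * Complex.I_sq]
    rw [← Complex.ofReal_exp, Real.exp_neg]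
    have he := Real.exp_pos (2 * π * a)
    have hne' : (Real.exp (2 * π * a) : ℂ) - 1 ≠ 0 := by exact_mod_cast hne
    have he' : (Real.exp (2 * π * a) : ℂ) ≠ 0 := by exact_mod_cast he.ne'
    push_cast at hne' he' ⊢
    have h5 : (1 : ℂ) - (Complex.exp (2 * π * a))⁻¹ ≠ 0 := by
      intro h6
      apply hne'
      field_simp at h6
      simpa using h6
    field_simp
    linear_combination (1 + Complex.exp (2 * π * a)) * Complex.I_sq
  set K := 1 + 2 / (Real.exp (2 * π * a) - 1)
  rw [hcot] at h
  have him := congrArg Complex.im h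
  have hre : (1 / (a * Complex.I : ℂ)) = ((-(1 / a) : ℝ) : ℂ) * Complex.I := by
    have : (a : ℂ) ≠ 0 := by exact_mod_cast ha.ne'
    push_cast
    field_simp
    linear_combination Complex.I_sq
  rw [hre] at him
  simp at him
  have hpow : a ^ (-(2 * 1 : ℝ)) = 1 / a ^ 2 := by
    rw [mul_one, Real.rpow_neg ha.le, Real.rpow_two, one_div]
  rw [hpow]
  field_simp at him ⊢
  linarith

theorem rowError_one {a : ℝ} (ha : 0 < a) :
    rowError a 1 = 2 * π / a / (Real.exp (2 * π * a) - 1) := by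
  rw [rowError, rowSum_one ha, halfBeta_one, show (1 : ℝ) - 2 * 1 = -1 by norm_num,
    Real.rpow_neg_one]
  field_simp
  ring

end RowSums

section KroneckerLimit

open Set Topology

theorem norm_rowError_mul_le {b : ℝ} (hb : 1 ≤ b) {s : ℝ} (hs : 1 ≤ s) (m : ℕ) :
    ‖rowError (b * (m + 1)) s‖ ≤ ((m : ℝ) + 1) ^ (-2 : ℝ) := by
  have hm : (1 : ℝ) ≤ m + 1 := by linarith [(Nat.cast_nonneg m : (0 : ℝ) ≤ m)]
  calc ‖rowError (b * (m + 1)) s‖ ≤ (b * (m + 1)) ^ (-(2 * s)) :=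
        abs_rowError_le (by positivity) hs
    _ ≤ ((m : ℝ) + 1) ^ (-(2 * s)) :=
        Real.rpow_le_rpow_of_nonpos (by linarith) (by nlinarith) (by linarith)
    _ ≤ ((m : ℝ) + 1) ^ (-2 : ℝ) :=
        Real.rpow_le_rpow_of_exponent_le hm (by linarith)

theorem summable_succ_rpow {r : ℝ} (hr : r < -1) : Summable fun m : ℕ => ((m : ℝ) + 1) ^ r := by
  simpa using (summable_nat_add_iff 1).mpr (Real.summable_nat_rpow.mpr hr)

theorem hasSum_rowSum_mul {b : ℝ} (hb : 1 ≤ b) {s : ℝ} (hs : 1 < s) :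
    HasSum (fun m : ℕ => rowSum (b * (m + 1)) s)
      (2 * b ^ (1 - 2 * s) * halfBeta s * (∑' n : ℕ, 1 / (n : ℝ) ^ (2 * s - 1)) +
        ∑' m : ℕ, rowError (b * (m + 1)) s) := by
  have hz : ∑' n : ℕ, 1 / (n : ℝ) ^ (2 * s - 1) = ∑' m : ℕ, ((m : ℝ) + 1) ^ (1 - 2 * s) := by
    have hsum : Summable fun n : ℕ => 1 / (n : ℝ) ^ (2 * s - 1) :=
      Real.summable_one_div_nat_rpow.mpr (by linarith)
    rw [hsum.tsum_eq_zero_add, Nat.cast_zero, Real.zero_rpow (by linarith), div_zero, zero_add]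
    refine tsum_congr fun m => ?_
    rw [Nat.cast_add_one, one_div, ← Real.rpow_neg (by positivity), neg_sub]
  have h1 := (summable_succ_rpow (r := 1 - 2 * s) (by linarith)).hasSum.mul_left
    (2 * b ^ (1 - 2 * s) * halfBeta s)
  have h2 : Summable fun m : ℕ => rowError (b * (m + 1)) s :=
    Summable.of_norm_bounded (summable_succ_rpow (r := -2) (by norm_num))
      (norm_rowError_mul_le hb hs.le)
  rw [hz]
  refine (h1.add h2.hasSum).congr_fun fun m => ?_
  rw [rowError, Real.mul_rpow (by linarith) (by positivity)]
  ring

theorem tendsto_tsum_rowError {b : ℝ} (hb : 1 ≤ b) :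
    Tendsto (fun s => ∑' m : ℕ, rowError (b * (m + 1)) s) (𝓝[>] 1)
      (𝓝 (∑' m : ℕ, rowError (b * (m + 1)) 1)) := by
  refine tendsto_tsum_of_dominated_convergence (summable_succ_rpow (r := -2) (by norm_num))
    (fun m => tendsto_rowError ?_) ?_
  · nlinarith [(Nat.cast_nonneg m : (0 : ℝ) ≤ m)]
  · filter_upwards [self_mem_nhdsWithin] with s hs m
    exact norm_rowError_mul_le hb (le_of_lt hs) m

theorem tsum_form_eq {b : ℝ} (hb : 1 ≤ b) {s : ℝ} (hs : 1 < s) :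
    ∑' v : ℤ × ℤ, ((v.1 : ℝ) ^ 2 + b ^ 2 * (v.2 : ℝ) ^ 2) ^ (-s) =
      rowSum 0 s + 2 * (2 * b ^ (1 - 2 * s) * halfBeta s * (∑' n : ℕ, 1 / (n : ℝ) ^ (2 * s - 1)) +
        ∑' m : ℕ, rowError (b * (m + 1)) s) := by
  have h := summable_form (a := 1) (b := b ^ 2) le_rfl (by nlinarith) hs
  simp only [one_mul] at h
  have h' := h.prod_symm
  rw [← (Equiv.prodComm ℤ ℤ).tsum_eq]
  simp only [Equiv.prodComm_apply]
  rw [h'.tsum_prod]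
  have hrow : ∀ y : ℤ, ∑' x : ℤ, (((Prod.swap (y, x)).1 : ℝ) ^ 2 +
      b ^ 2 * ((Prod.swap (y, x)).2 : ℝ) ^ 2) ^ (-s) = rowSum (b * y) s := fun y => by
    simp only [rowSum, Prod.swap_prod_mk, mul_pow]
  have hsum : Summable fun y : ℤ => rowSum (b * y) s := h'.prod.congr fun y => hrow y
  rw [tsum_congr hrow]
  have heven := hasSum_int_of_even (f := fun y : ℤ => rowSum (b * y) s)
    (fun n => by simp [rowSum]) (hsum.comp_injective Nat.cast_injective)
  rw [heven.tsum_eq, ← (hasSum_rowSum_mul hb hs).tsum_eq]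
  simp

theorem tendsto_rowSum_zero : Tendsto (rowSum 0) (𝓝[>] 1) (𝓝 (π ^ 2 / 3)) := by
  have hlim : Tendsto (fun s : ℝ => ∑' n : ℕ, ((n : ℝ) + 1) ^ (-(2 * s))) (𝓝[>] 1)
      (𝓝 (∑' n : ℕ, ((n : ℝ) + 1) ^ (-(2 * 1 : ℝ)))) := by
    refine tendsto_tsum_of_dominated_convergence (summable_succ_rpow (r := -2) (by norm_num))
      (fun n => ?_) ?_
    · have : Continuous fun s : ℝ => ((n : ℝ) + 1) ^ (-(2 * s)) :=
        (Real.continuous_const_rpow (by positivity)).comp (by fun_prop)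
      exact this.continuousAt.mono_left nhdsWithin_le_nhds
    · filter_upwards [self_mem_nhdsWithin] with s hs n
      have hs : 1 < s := hs
      rw [Real.norm_of_nonneg (by positivity)]
      exact Real.rpow_le_rpow_of_exponent_le
        (by linarith [(Nat.cast_nonneg n : (0 : ℝ) ≤ n)]) (by linarith)
  have hval : ∑' n : ℕ, ((n : ℝ) + 1) ^ (-(2 * 1 : ℝ)) = π ^ 2 / 6 := by
    rw [← hasSum_zeta_two.tsum_eq, hasSum_zeta_two.summable.tsum_eq_zero_add]
    simp only [Nat.cast_zero, ne_eq, OfNat.ofNat_ne_zero, not_false_eq_true, zero_pow, div_zero,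
      zero_add, Nat.cast_add_one]
    refine tsum_congr fun n => ?_
    rw [mul_one, Real.rpow_neg (by positivity), Real.rpow_two, one_div]
  rw [hval] at hlim
  have h2 := hlim.const_mul 2
  rw [show 2 * (π ^ 2 / 6) = π ^ 2 / 3 by ring] at h2
  refine h2.congr' ?_
  filter_upwards [self_mem_nhdsWithin] with s hs
  have hs : 1 < s := hs
  have hpow : ∀ t : ℝ, 0 ≤ t → (t ^ 2 + 0 ^ 2) ^ (-s) = t ^ (-(2 * s)) := fun t ht => by
    rw [show -(2 * s) = 2 * -s by ring, Real.rpow_mul ht, Real.rpow_two]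
    simp
  have h := hasSum_int_of_even (f := fun x : ℤ => ((x : ℝ) ^ 2 + 0 ^ 2) ^ (-s)) (fun n => by simp) ?_
  · rw [rowSum, h.tsum_eq]
    push_cast
    rw [hpow 0 le_rfl, Real.zero_rpow (by linarith), zero_add]
    congr 1
    exact tsum_congr fun n => (hpow _ (by positivity)).symm
  · refine (Real.summable_nat_rpow.mpr (show -(2 * s) < -1 by linarith)).congr fun n => ?_
    rw [Int.cast_natCast, hpow _ (by positivity)]

/-- The logarithm of the Euler product `∏ (1 - x^k)`. -/
noncomputable def logEuler (x : ℝ) : ℝ := ∑' k : ℕ, Real.log (1 - x ^ (k + 1))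

theorem tsum_lambert {x : ℝ} (h0 : 0 < x) (h1 : x < 1) :
    ∑' m : ℕ, 1 / ((m : ℝ) + 1) * (x ^ (m + 1) / (1 - x ^ (m + 1))) = -logEuler x := by
  have hpow : ∀ k : ℕ, 0 < x ^ (k + 1) ∧ x ^ (k + 1) < 1 := fun k =>
    ⟨by positivity, pow_lt_one₀ h0.le h1 (by omega)⟩
  have hlog : ∀ k : ℕ, HasSum (fun m : ℕ => (x ^ (k + 1)) ^ (m + 1) / ((m : ℝ) + 1))
      (-Real.log (1 - x ^ (k + 1))) := fun k => by
    refine Real.hasSum_pow_div_log_of_abs_lt_one ?_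
    rw [abs_of_pos (hpow k).1]
    exact (hpow k).2
  have hgeo : ∀ m : ℕ, HasSum (fun k : ℕ => (x ^ (k + 1)) ^ (m + 1) / ((m : ℝ) + 1))
      (1 / ((m : ℝ) + 1) * (x ^ (m + 1) / (1 - x ^ (m + 1)))) := fun m => by
    have := (hasSum_geometric_of_lt_one (hpow m).1.le (hpow m).2).mul_left
      (x ^ (m + 1) / ((m : ℝ) + 1))
    have h := (hpow m).2
    convert! this using 1
    · funext k
      rw [← pow_mul, ← pow_mul, mul_comm (k + 1), mul_add, pow_add]
      ring
    · ring
  have hsum : Summable (Function.uncurry fun k m : ℕ =>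
      (x ^ (k + 1)) ^ (m + 1) / ((m : ℝ) + 1)) := by
    have hg := summable_geometric_of_lt_one h0.le h1
    refine (hg.mul_of_nonneg hg (fun _ => by positivity) fun _ => by positivity).of_nonneg_of_le
      (fun p => by rw [Function.uncurry]; positivity) fun p => ?_
    rw [Function.uncurry]
    calc (x ^ (p.1 + 1)) ^ (p.2 + 1) / ((p.2 : ℝ) + 1) ≤ (x ^ (p.1 + 1)) ^ (p.2 + 1) :=
          div_le_self (by positivity) (by linarith [(Nat.cast_nonneg p.2 : (0 : ℝ) ≤ p.2)])
      _ ≤ x ^ (p.1 + p.2) := by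
          rw [← pow_mul]
          exact pow_le_pow_of_le_one h0.le h1.le (by nlinarith)
      _ = x ^ p.1 * x ^ p.2 := pow_add _ _ _
  calc ∑' m : ℕ, 1 / ((m : ℝ) + 1) * (x ^ (m + 1) / (1 - x ^ (m + 1)))
      = ∑' m : ℕ, ∑' k : ℕ, (x ^ (k + 1)) ^ (m + 1) / ((m : ℝ) + 1) :=
        tsum_congr fun m => (hgeo m).tsum_eq.symm
    _ = ∑' k : ℕ, ∑' m : ℕ, (x ^ (k + 1)) ^ (m + 1) / ((m : ℝ) + 1) := hsum.tsum_comm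
    _ = ∑' k : ℕ, -Real.log (1 - x ^ (k + 1)) := tsum_congr fun k => (hlog k).tsum_eq
    _ = -logEuler x := tsum_neg

theorem tsum_rowError_one {b : ℝ} (hb : 0 < b) :
    ∑' m : ℕ, rowError (b * (m + 1)) 1 = -(2 * π / b) * logEuler (Real.exp (-(2 * π * b))) := by
  have hx1 : Real.exp (-(2 * π * b)) < 1 := by
    rw [Real.exp_lt_one_iff]
    have : 0 < 2 * π * b := by positivity
    linarith
  rw [neg_mul, ← mul_neg, ← tsum_lambert (Real.exp_pos _) hx1, ← tsum_mul_left]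
  refine tsum_congr fun m => ?_
  rw [rowError_one (by positivity), ← Real.exp_nat_mul]
  have hexp : Real.exp (((m + 1 : ℕ) : ℝ) * -(2 * π * b)) =
      (Real.exp (2 * π * (b * (m + 1))))⁻¹ := by
    rw [← Real.exp_neg]
    congr 1
    push_cast
    ring
  rw [hexp]
  set E := Real.exp (2 * π * (b * (m + 1)))
  have hE : 1 < E := Real.one_lt_exp_iff.mpr (by positivity)
  have h1 : E - 1 ≠ 0 := by linarith
  have h2 : 1 - E⁻¹ ≠ 0 := by
    have := inv_lt_one_of_one_lt₀ hE
    linarith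
  have h3 : 1 - E⁻¹ = (E - 1) / E := by
    field_simp
  rw [h3]
  field_simp

theorem tendsto_one_sub_two_rpow_mul_zeta :
    Tendsto (fun s : ℝ => (1 - 2 ^ (s - 1)) * ∑' n : ℕ, 1 / (n : ℝ) ^ (2 * s - 1)) (𝓝[>] 1)
      (𝓝 (-(Real.log 2 / 2))) := by
  have hmap : Tendsto (fun s : ℝ => 2 * s - 1) (𝓝[>] 1) (𝓝[>] 1) := by
    refine tendsto_nhdsWithin_iff.mpr ⟨?_, ?_⟩
    · have : Continuous fun s : ℝ => 2 * s - 1 := by fun_prop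
      have := this.tendsto 1
      norm_num at this
      exact this.mono_left nhdsWithin_le_nhds
    · filter_upwards [self_mem_nhdsWithin] with s hs
      have hs : 1 < s := hs
      show 1 < 2 * s - 1
      linarith
  have hz := tendsto_sub_mul_tsum_nat_rpow.comp hmap
  have hd : HasDerivAt (fun s : ℝ => (2 : ℝ) ^ (s - 1)) (Real.log 2) 1 := by
    have := ((hasDerivAt_id (1 : ℝ)).sub_const 1).const_rpow (a := 2) (by norm_num)
    simpa using this
  have hslope := hd.tendsto_slope.mono_left
    (nhdsWithin_mono 1 fun s (hs : s ∈ Ioi (1 : ℝ)) => ne_of_gt hs)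
  have h := (hslope.mul hz).div_const (-2)
  rw [show Real.log 2 * 1 / -2 = -(Real.log 2 / 2) by ring] at h
  refine h.congr' ?_
  filter_upwards [self_mem_nhdsWithin] with s hs
  have hs : 1 < s := hs
  have : s - 1 ≠ 0 := by linarith
  simp only [slope_def_field, Function.comp_apply, sub_self, Real.rpow_zero]
  field_simp
  ring

theorem sqrt_58_eq : √58 = √29 * √2 := by
  rw [← Real.sqrt_mul (by norm_num)]
  norm_num

/-- The value of the Weber function `2^(-1/2) q^(-1/12) ∏ (1 - q^(2k-1))²` at
`q = exp (-π √58)`, in logarithmic form. -/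
theorem kronecker_limit_58 :
    π * √58 / 12 - Real.log 2 / 2 +
      2 * (logEuler (Real.exp (-(π * √58))) - logEuler (Real.exp (-(π * √58)) ^ 2)) =
      Real.log ((5 + √29) / 2) := by
  set b := √58 with hb
  have hb2 : b ^ 2 = 58 := Real.sq_sqrt (by norm_num)
  have hb0 : 0 < b := Real.sqrt_pos.mpr (by norm_num)
  have hb1 : 1 ≤ b / 2 := by nlinarith
  have hlim : Tendsto (fun s : ℝ => (1 - 2 ^ (-s)) * rowSum 0 s +
      4 * b ^ (1 - 2 * s) * halfBeta s *
        ((1 - 2 ^ (s - 1)) * ∑' n : ℕ, 1 / (n : ℝ) ^ (2 * s - 1)) +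
      2 * ∑' m : ℕ, rowError (b * (m + 1)) s -
      2 * 2 ^ (-s) * ∑' m : ℕ, rowError (b / 2 * (m + 1)) s) (𝓝[>] 1)
      (𝓝 ((1 - 2 ^ (-1 : ℝ)) * (π ^ 2 / 3) +
        4 * b ^ ((1 : ℝ) - 2 * 1) * (π / 2) * (-(Real.log 2 / 2)) +
        2 * ∑' m : ℕ, rowError (b * (m + 1)) 1 -
        2 * 2 ^ (-1 : ℝ) * ∑' m : ℕ, rowError (b / 2 * (m + 1)) 1)) := by
    have h2 : Tendsto (fun s : ℝ => (2 : ℝ) ^ (-s)) (𝓝[>] 1) (𝓝 (2 ^ (-1 : ℝ))) := by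
      have : Continuous fun s : ℝ => (2 : ℝ) ^ (-s) :=
        (Real.continuous_const_rpow (by norm_num)).comp continuous_neg
      exact this.continuousAt.mono_left nhdsWithin_le_nhds
    have h3 : Tendsto (fun s : ℝ => b ^ (1 - 2 * s)) (𝓝[>] 1) (𝓝 (b ^ ((1 : ℝ) - 2 * 1))) := by
      have : Continuous fun s : ℝ => b ^ (1 - 2 * s) :=
        (Real.continuous_const_rpow hb0.ne').comp (by fun_prop)
      exact this.continuousAt.mono_left nhdsWithin_le_nhds
    exact ((((h2.const_sub 1).mul tendsto_rowSum_zero).add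
      (((h3.const_mul 4).mul tendsto_halfBeta).mul tendsto_one_sub_two_rpow_mul_zeta)).add
      ((tendsto_tsum_rowError (by linarith)).const_mul 2)).sub
      ((h2.const_mul 2).mul (tendsto_tsum_rowError hb1))
  have heq := tendsto_nhds_unique (tendsto_form_diff.congr' ?_) hlim
  · rw [tsum_rowError_one hb0, tsum_rowError_one (half_pos hb0), Real.rpow_neg_one,
      show (1 : ℝ) - 2 * 1 = -1 by norm_num, Real.rpow_neg_one,
      show -(2 * π * (b / 2)) = -(π * b) by ring] at heq
    rw [← Real.exp_nat_mul, show ((2 : ℕ) : ℝ) * -(π * b) = -(2 * π * b) by push_cast; ring]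
    have h29 : √29 * √2 = b := sqrt_58_eq.symm
    have hs29 : (0 : ℝ) < √29 := Real.sqrt_pos.mpr (by norm_num)
    have hs2 : (0 : ℝ) < √2 := Real.sqrt_pos.mpr (by norm_num)
    have hleft : 2 * ((2 * Real.log ((5 + √29) / 2) / √29) * (π / (2 * √2))) =
        2 * π * Real.log ((5 + √29) / 2) / b := by
      rw [← h29]
      field_simp
    rw [hleft] at heq
    have hpi := Real.pi_pos
    field_simp at heq ⊢
    linarith
  · filter_upwards [self_mem_nhdsWithin] with s hs
    have hs : 1 < s := hs
    have hF := tsum_form_eq (b := b) (by linarith) hs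
    have hG := tsum_form_eq (b := b / 2) hb1 hs
    have hG' : ∑' v : ℤ × ℤ, (2 * (v.1 : ℝ) ^ 2 + 29 * (v.2 : ℝ) ^ 2) ^ (-s) =
        2 ^ (-s) * ∑' v : ℤ × ℤ, ((v.1 : ℝ) ^ 2 + (b / 2) ^ 2 * (v.2 : ℝ) ^ 2) ^ (-s) := by
      rw [← tsum_mul_left]
      refine tsum_congr fun v => ?_
      rw [← Real.mul_rpow (by norm_num) (by positivity)]
      congr 1
      linear_combination (-(v.2 : ℝ) ^ 2 / 2) * hb2
    rw [hb2] at hF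
    rw [hF, hG', hG, Real.div_rpow hb0.le (by norm_num)]
    have h2pow : (2 : ℝ) ^ (-s) = 2 ^ (s - 1) * 2 ^ (1 - 2 * s) := by
      rw [← Real.rpow_add (by norm_num)]
      congr 1
      ring
    have hpos : (0 : ℝ) < 2 ^ (1 - 2 * s) := by positivity
    rw [h2pow]
    field_simp
    ring

end KroneckerLimit

section TripleProduct

open Set Topology

/-- The Euler product `∏ (1 - x^k)`. -/
noncomputable def eulerProd (x : ℝ) : ℝ := Real.exp (logEuler x)

theorem eulerProd_pos (x : ℝ) : 0 < eulerProd x := Real.exp_pos _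

theorem one_sub_pow_succ_pos {x : ℝ} (h0 : 0 < x) (h1 : x < 1) (k : ℕ) : 0 < 1 - x ^ (k + 1) :=
  sub_pos.mpr (pow_lt_one₀ h0.le h1 (Nat.succ_ne_zero k))

theorem summable_log_one_sub_pow {x : ℝ} (h0 : 0 < x) (h1 : x < 1) :
    Summable fun k : ℕ => Real.log (1 - x ^ (k + 1)) := by
  have hs : Summable fun k : ℕ => -(x ^ (k + 1)) :=
    ((summable_nat_add_iff 1).mpr (summable_geometric_of_lt_one h0.le h1)).neg
  simpa [sub_eq_add_neg] using Real.summable_log_one_add_of_summable hs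

theorem tendsto_eulerProd {x : ℝ} (h0 : 0 < x) (h1 : x < 1) :
    Tendsto (fun n => ∏ k ∈ Finset.range n, (1 - x ^ (k + 1))) atTop (𝓝 (eulerProd x)) := by
  have h := (Real.continuous_exp.tendsto _).comp
    (summable_log_one_sub_pow h0 h1).hasSum.tendsto_sum_nat
  refine h.congr fun n => ?_
  rw [Function.comp_apply, Real.exp_sum]
  refine Finset.prod_congr rfl fun k _ =>
    Real.exp_log (one_sub_pow_succ_pos h0 h1 k)

theorem eulerProd_le_prod {x : ℝ} (h0 : 0 < x) (h1 : x < 1) (n : ℕ) :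
    eulerProd x ≤ ∏ k ∈ Finset.range n, (1 - x ^ (k + 1)) := by
  refine Antitone.le_of_tendsto (antitone_nat_of_succ_le fun n => ?_) (tendsto_eulerProd h0 h1) n
  rw [Finset.prod_range_succ]
  refine mul_le_of_le_one_right
    (Finset.prod_nonneg fun k _ => (one_sub_pow_succ_pos h0 h1 k).le) ?_
  linarith [pow_pos h0 (n + 1)]

/-- The reciprocal `1 / (Q; Q)_m` of a `q`-Pochhammer symbol, extended by zero to `m < 0`. -/
noncomputable def pochInv (Q : ℝ) (m : ℤ) : ℝ :=
  if m < 0 then 0 else (∏ k ∈ Finset.range m.toNat, (1 - Q ^ (k + 1)))⁻¹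

theorem pochInv_natCast (Q : ℝ) (m : ℕ) :
    pochInv Q m = (∏ k ∈ Finset.range m, (1 - Q ^ (k + 1)))⁻¹ := by
  simp [pochInv]

theorem pochInv_sub_one {Q : ℝ} (h0 : 0 < Q) (h1 : Q < 1) (m : ℤ) :
    pochInv Q (m - 1) = (1 - Q ^ m) * pochInv Q m := by
  rcases lt_trichotomy m 0 with hm | rfl | hm
  · simp [pochInv, hm, show m - 1 < 0 by omega]
  · simp [pochInv]
  · obtain ⟨n, rfl⟩ : ∃ n : ℕ, m = (n : ℤ) + 1 := ⟨(m - 1).toNat, by omega⟩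
    have hn : (1 : ℝ) - Q ^ (n + 1) ≠ 0 := (one_sub_pow_succ_pos h0 h1 n).ne'
    rw [add_sub_cancel_right, pochInv_natCast, show (n : ℤ) + 1 = ((n + 1 : ℕ) : ℤ) by push_cast; rfl,
      pochInv_natCast, Finset.prod_range_succ, zpow_natCast, mul_inv]
    field_simp

theorem pochInv_nonneg {Q : ℝ} (h0 : 0 < Q) (h1 : Q < 1) (m : ℤ) : 0 ≤ pochInv Q m := by
  rw [pochInv]
  split_ifs
  · exact le_rfl
  · exact inv_nonneg.mpr (Finset.prod_nonneg fun k _ => (one_sub_pow_succ_pos h0 h1 k).le)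

theorem pochInv_le {Q : ℝ} (h0 : 0 < Q) (h1 : Q < 1) (m : ℤ) :
    pochInv Q m ≤ (eulerProd Q)⁻¹ := by
  rw [pochInv]
  split_ifs
  · exact inv_nonneg.mpr (eulerProd_pos Q).le
  · exact inv_anti₀ (eulerProd_pos Q) (eulerProd_le_prod h0 h1 _)

theorem tendsto_pochInv {Q : ℝ} (h0 : 0 < Q) (h1 : Q < 1) {u : ℕ → ℤ}
    (hu : Tendsto u atTop atTop) :
    Tendsto (fun n => pochInv Q (u n)) atTop (𝓝 (eulerProd Q)⁻¹) := by
  have hnat : Tendsto (fun n => (u n).toNat) atTop atTop :=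
    tendsto_atTop.mpr fun b => by
      filter_upwards [hu.eventually_ge_atTop (b : ℤ)] with n hn
      omega
  refine (((tendsto_eulerProd h0 h1).comp hnat).inv₀ (eulerProd_pos Q).ne').congr' ?_
  filter_upwards [hu.eventually_ge_atTop 0] with n hn
  simp [pochInv, not_lt.mpr hn]

/-- The coefficient of `q^(j²) z^j` in the finite triple product. -/
noncomputable def tripleCoeff (Q : ℝ) (n : ℕ) (j : ℤ) : ℝ :=
  (∏ k ∈ Finset.range (2 * n), (1 - Q ^ (k + 1))) * (pochInv Q (n - j) * pochInv Q (n + j))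

theorem tripleCoeff_succ {Q : ℝ} (h0 : 0 < Q) (h1 : Q < 1) (n : ℕ) (j : ℤ) :
    tripleCoeff Q (n + 1) j = (1 + Q ^ (2 * n + 1)) * tripleCoeff Q n j +
      (Q ^ ((n : ℤ) + 1 - j) * tripleCoeff Q n (j - 1) +
        Q ^ ((n : ℤ) + 1 + j) * tripleCoeff Q n (j + 1)) := by
  have hA := pochInv_sub_one h0 h1 ((n : ℤ) + 1 - j)
  have hA' := pochInv_sub_one h0 h1 ((n : ℤ) - j)
  have hB := pochInv_sub_one h0 h1 ((n : ℤ) + 1 + j)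
  have hB' := pochInv_sub_one h0 h1 ((n : ℤ) + j)
  rw [show (n : ℤ) + 1 - j - 1 = n - j by ring] at hA
  rw [show (n : ℤ) + 1 + j - 1 = n + j by ring] at hB
  have hX : Q ^ ((n : ℤ) + 1 - j) = Q ^ ((n : ℤ) - j) * Q := by
    rw [← zpow_add_one₀ h0.ne']
    congr 1
    ring
  have hY : Q ^ ((n : ℤ) + 1 + j) = Q ^ ((n : ℤ) + j) * Q := by
    rw [← zpow_add_one₀ h0.ne']
    congr 1
    ring
  have hXY : Q ^ (2 * n) = Q ^ ((n : ℤ) - j) * Q ^ ((n : ℤ) + j) := by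
    rw [← zpow_add₀ h0.ne', ← zpow_natCast]
    congr 1
    push_cast
    ring
  simp only [tripleCoeff, show 2 * (n + 1) = 2 * n + 1 + 1 by ring, Finset.prod_range_succ]
  rw [show ((n + 1 : ℕ) : ℤ) - j = n + 1 - j by push_cast; ring,
    show ((n + 1 : ℕ) : ℤ) + j = n + 1 + j by push_cast; ring,
    show (n : ℤ) - (j - 1) = n + 1 - j by ring, show (n : ℤ) + (j - 1) = n + j - 1 by ring,
    show (n : ℤ) - (j + 1) = n - j - 1 by ring, show (n : ℤ) + (j + 1) = n + 1 + j by ring,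
    hA', hB', hA, hB, hX, hY, pow_succ Q (2 * n + 1), pow_succ Q (2 * n), hXY]
  ring

theorem hasSum_finite_triple_product {q : ℝ} (h0 : 0 < q) (h1 : q < 1) {z : ℝ} (hz : z ≠ 0)
    (n : ℕ) :
    HasSum (fun j : ℤ => tripleCoeff (q ^ 2) n j * (q ^ (j ^ 2) * z ^ j))
      (∏ k ∈ Finset.range n, ((1 + z * q ^ (2 * k + 1)) * (1 + z⁻¹ * q ^ (2 * k + 1)))) := by
  have hQ0 : 0 < q ^ 2 := by positivity
  have hQ1 : q ^ 2 < 1 := pow_lt_one₀ h0.le h1 two_ne_zero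
  induction n with
  | zero =>
    have h := hasSum_single (f := fun j : ℤ => tripleCoeff (q ^ 2) 0 j * (q ^ (j ^ 2) * z ^ j)) 0
      (fun j hj => by
        rcases lt_or_gt_of_ne hj with h | h
        · simp [tripleCoeff, pochInv, h]
        · simp [tripleCoeff, pochInv, h])
    simpa [tripleCoeff, pochInv] using h
  | succ n ih =>
    have hl := (Equiv.subRight (1 : ℤ)).hasSum_iff.mpr ih
    have hr := (Equiv.addRight (1 : ℤ)).hasSum_iff.mpr ih
    have h := (ih.mul_left (1 + (q ^ 2) ^ (2 * n + 1))).add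
      ((hl.mul_left (q ^ (2 * n + 1) * z)).add (hr.mul_left (q ^ (2 * n + 1) * z⁻¹)))
    rw [Finset.prod_range_succ]
    convert! h using 1
    · funext j
      simp only [Function.comp_apply, Equiv.subRight_apply, Equiv.coe_addRight]
      rw [tripleCoeff_succ hQ0 hQ1, zpow_sub_one₀ hz, zpow_add_one₀ hz]
      have e1 : (q ^ 2) ^ ((n : ℤ) + 1 - j) * q ^ (j ^ 2) =
          q ^ (2 * n + 1) * q ^ ((j - 1) ^ 2) := by
        rw [← zpow_natCast q 2, ← zpow_natCast q (2 * n + 1), ← zpow_mul, ← zpow_add₀ h0.ne',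
          ← zpow_add₀ h0.ne']
        congr 1
        push_cast
        ring
      have e2 : (q ^ 2) ^ ((n : ℤ) + 1 + j) * q ^ (j ^ 2) =
          q ^ (2 * n + 1) * q ^ ((j + 1) ^ 2) := by
        rw [← zpow_natCast q 2, ← zpow_natCast q (2 * n + 1), ← zpow_mul, ← zpow_add₀ h0.ne',
          ← zpow_add₀ h0.ne']
        congr 1
        push_cast
        ring
      field_simp
      linear_combination tripleCoeff (q ^ 2) n (j - 1) * e1 + tripleCoeff (q ^ 2) n (j + 1) * e2
    · field_simp
      ring

/-- The **Jacobi triple product**, as a limit of finite products. -/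
theorem tendsto_triple_product {q : ℝ} (h0 : 0 < q) (h1 : q < 1) {z : ℝ} (hz : z ≠ 0)
    (hs : Summable fun j : ℤ => ‖q ^ (j ^ 2) * z ^ j‖) :
    Tendsto (fun n => ∏ k ∈ Finset.range n,
        ((1 + z * q ^ (2 * k + 1)) * (1 + z⁻¹ * q ^ (2 * k + 1)))) atTop
      (𝓝 ((eulerProd (q ^ 2))⁻¹ * ∑' j : ℤ, q ^ (j ^ 2) * z ^ j)) := by
  have hQ0 : 0 < q ^ 2 := by positivity
  have hQ1 : q ^ 2 < 1 := pow_lt_one₀ h0.le h1 two_ne_zero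
  have hE := eulerProd_pos (q ^ 2)
  have hfac : ∀ k : ℕ, 0 ≤ 1 - (q ^ 2) ^ (k + 1) ∧ 1 - (q ^ 2) ^ (k + 1) ≤ 1 := fun k =>
    ⟨(one_sub_pow_succ_pos hQ0 hQ1 k).le, by linarith [pow_pos hQ0 (k + 1)]⟩
  rw [← tsum_mul_left]
  simp only [← fun n => (hasSum_finite_triple_product h0 h1 hz n).tsum_eq]
  refine tendsto_tsum_of_dominated_convergence
    (hs.mul_left ((eulerProd (q ^ 2))⁻¹ * (eulerProd (q ^ 2))⁻¹)) (fun j => ?_)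
    (Eventually.of_forall fun n j => ?_)
  · refine Tendsto.mul_const _ ?_
    have ha : Tendsto (fun n : ℕ => (n : ℤ) - j) atTop atTop :=
      tendsto_atTop_add_const_right _ _ tendsto_natCast_atTop_atTop
    have hb : Tendsto (fun n : ℕ => (n : ℤ) + j) atTop atTop :=
      tendsto_atTop_add_const_right _ _ tendsto_natCast_atTop_atTop
    have h2 : Tendsto (fun n : ℕ => 2 * n) atTop atTop :=
      tendsto_id.const_mul_atTop' two_pos
    have h := ((tendsto_eulerProd hQ0 hQ1).comp h2).mul
      ((tendsto_pochInv hQ0 hQ1 ha).mul (tendsto_pochInv hQ0 hQ1 hb))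
    rwa [mul_inv_cancel_left₀ hE.ne'] at h
  · rw [norm_mul]
    refine mul_le_mul_of_nonneg_right ?_ (norm_nonneg _)
    have hp := pochInv_nonneg hQ0 hQ1
    rw [tripleCoeff, Real.norm_of_nonneg
      (mul_nonneg (Finset.prod_nonneg fun k _ => (hfac k).1) (mul_nonneg (hp _) (hp _)))]
    refine (mul_le_of_le_one_left (mul_nonneg (hp _) (hp _))
      (Finset.prod_le_one (fun k _ => (hfac k).1) fun k _ => (hfac k).2)).trans ?_
    exact mul_le_mul (pochInv_le hQ0 hQ1 _) (pochInv_le hQ0 hQ1 _) (hp _) (inv_nonneg.mpr hE.le)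

theorem summable_zpow_of_natAbs_le {q : ℝ} (h0 : 0 < q) (h1 : q < 1) {e : ℤ → ℤ}
    (he : ∀ j, (j.natAbs : ℤ) - 1 ≤ e j) : Summable fun j : ℤ => q ^ e j := by
  have hg := summable_geometric_of_lt_one h0.le h1
  have habs : Summable fun j : ℤ => q ^ j.natAbs := by
    refine Summable.of_nat_of_neg ?_ ?_ <;> simpa using hg
  refine (habs.mul_left q⁻¹).of_nonneg_of_le (fun j => by positivity) fun j => ?_
  calc q ^ e j ≤ q ^ ((j.natAbs : ℤ) - 1) := zpow_le_zpow_right_of_le_one₀ h0 h1.le (he j)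
    _ = q⁻¹ * q ^ j.natAbs := by rw [zpow_sub_one₀ h0.ne', zpow_natCast, mul_comm]

theorem natAbs_sub_one_le_sq (j : ℤ) : (j.natAbs : ℤ) - 1 ≤ j ^ 2 := by
  have := Int.natAbs_sq j
  nlinarith [sq_nonneg ((j.natAbs : ℤ) - 1)]

theorem natAbs_sub_one_le_sq_add (j : ℤ) : (j.natAbs : ℤ) - 1 ≤ j ^ 2 + j := by
  rcases le_total 0 j with h | h
  · rw [Int.natAbs_of_nonneg h]
    nlinarith
  · rw [show (j.natAbs : ℤ) = -j by omega]
    nlinarith [sq_nonneg (j + 1)]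

end TripleProduct

section ThetaProducts

open Set Topology

theorem prod_range_two_mul_one_sub_pow (q : ℝ) (n : ℕ) :
    ∏ k ∈ Finset.range (2 * n), (1 - q ^ (k + 1)) =
      (∏ k ∈ Finset.range n, (1 - q ^ (2 * k + 1))) *
        ∏ k ∈ Finset.range n, (1 - (q ^ 2) ^ (k + 1)) := by
  induction n with
  | zero => simp
  | succ n ih =>
    rw [show 2 * (n + 1) = 2 * n + 1 + 1 by ring, Finset.prod_range_succ, Finset.prod_range_succ,
      ih, Finset.prod_range_succ, Finset.prod_range_succ, ← pow_mul,
      show 2 * (n + 1) = 2 * n + 1 + 1 by ring]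
    ring

theorem tendsto_prod_one_sub_odd {q : ℝ} (h0 : 0 < q) (h1 : q < 1) :
    Tendsto (fun n => ∏ k ∈ Finset.range n, (1 - q ^ (2 * k + 1))) atTop
      (𝓝 (eulerProd q / eulerProd (q ^ 2))) := by
  have hQ0 : 0 < q ^ 2 := by positivity
  have hQ1 : q ^ 2 < 1 := pow_lt_one₀ h0.le h1 two_ne_zero
  have h2 : Tendsto (fun n : ℕ => 2 * n) atTop atTop := tendsto_id.const_mul_atTop' two_pos
  refine (((tendsto_eulerProd h0 h1).comp h2).div (tendsto_eulerProd hQ0 hQ1)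
    (eulerProd_pos _).ne').congr fun n => ?_
  rw [Pi.div_apply, Function.comp_apply, prod_range_two_mul_one_sub_pow, mul_div_cancel_right₀]
  exact Finset.prod_ne_zero_iff.mpr fun k _ => (one_sub_pow_succ_pos hQ0 hQ1 k).ne'

theorem prod_one_add_mul_prod_one_sub {ι : Type*} (s : Finset ι) (f : ι → ℝ) :
    (∏ k ∈ s, (1 + f k)) * ∏ k ∈ s, (1 - f k) = ∏ k ∈ s, (1 - f k ^ 2) := by
  rw [← Finset.prod_mul_distrib]
  exact Finset.prod_congr rfl fun k _ => by ring

theorem tendsto_prod_one_add_pow {x : ℝ} (h0 : 0 < x) (h1 : x < 1) :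
    Tendsto (fun n => ∏ k ∈ Finset.range n, (1 + x ^ (k + 1))) atTop
      (𝓝 (eulerProd (x ^ 2) / eulerProd x)) := by
  have hQ0 : 0 < x ^ 2 := by positivity
  have hQ1 : x ^ 2 < 1 := pow_lt_one₀ h0.le h1 two_ne_zero
  refine ((tendsto_eulerProd hQ0 hQ1).div (tendsto_eulerProd h0 h1)
    (eulerProd_pos _).ne').congr fun n => ?_
  rw [Pi.div_apply, div_eq_iff
    (Finset.prod_ne_zero_iff.mpr fun k _ => (one_sub_pow_succ_pos h0 h1 k).ne'),
    prod_one_add_mul_prod_one_sub]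
  exact Finset.prod_congr rfl fun k _ => by ring

theorem tendsto_prod_one_add_odd {q : ℝ} (h0 : 0 < q) (h1 : q < 1) :
    Tendsto (fun n => ∏ k ∈ Finset.range n, (1 + q ^ (2 * k + 1))) atTop
      (𝓝 (eulerProd (q ^ 2) / eulerProd (q ^ 4) / (eulerProd q / eulerProd (q ^ 2)))) := by
  have hQ0 : 0 < q ^ 2 := by positivity
  have hQ1 : q ^ 2 < 1 := pow_lt_one₀ h0.le h1 two_ne_zero
  have h := (tendsto_prod_one_sub_odd hQ0 hQ1).div (tendsto_prod_one_sub_odd h0 h1)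
    (div_pos (eulerProd_pos _) (eulerProd_pos _)).ne'
  rw [show (q ^ 2) ^ 2 = q ^ 4 by ring] at h
  refine h.congr fun n => ?_
  rw [Pi.div_apply, div_eq_iff
    (Finset.prod_ne_zero_iff.mpr fun k _ => (one_sub_pow_succ_pos h0 h1 (2 * k)).ne'),
    prod_one_add_mul_prod_one_sub]
  exact Finset.prod_congr rfl fun k _ => by ring

theorem summable_zpow_sq {q : ℝ} (h0 : 0 < q) (h1 : q < 1) :
    Summable fun j : ℤ => ‖q ^ (j ^ 2) * (1 : ℝ) ^ j‖ := by
  simpa using (summable_zpow_of_natAbs_le h0 h1 natAbs_sub_one_le_sq).norm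

theorem summable_alternating_zpow_sq {q : ℝ} (h0 : 0 < q) (h1 : q < 1) :
    Summable fun j : ℤ => ‖q ^ (j ^ 2) * (-1 : ℝ) ^ j‖ := by
  simpa [norm_mul, norm_zpow] using (summable_zpow_of_natAbs_le h0 h1 natAbs_sub_one_le_sq).norm

theorem summable_zpow_sq_add {q : ℝ} (h0 : 0 < q) (h1 : q < 1) :
    Summable fun j : ℤ => ‖q ^ (j ^ 2) * q ^ j‖ := by
  simpa only [zpow_add₀ h0.ne'] using
    (summable_zpow_of_natAbs_le h0 h1 natAbs_sub_one_le_sq_add).norm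

theorem tsum_alternating_zpow_sq {q : ℝ} (h0 : 0 < q) (h1 : q < 1) :
    ∑' j : ℤ, q ^ (j ^ 2) * (-1 : ℝ) ^ j = eulerProd q ^ 2 / eulerProd (q ^ 2) := by
  have hE := (eulerProd_pos (q ^ 2)).ne'
  have h := tendsto_triple_product h0 h1 (neg_ne_zero.mpr one_ne_zero)
    (summable_alternating_zpow_sq h0 h1)
  have h' := (tendsto_prod_one_sub_odd h0 h1).mul (tendsto_prod_one_sub_odd h0 h1)
  have e := tendsto_nhds_unique h (h'.congr fun n => by
    rw [← Finset.prod_mul_distrib]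
    exact Finset.prod_congr rfl fun k _ => by norm_num [sub_eq_add_neg])
  field_simp at e ⊢
  exact e

theorem tsum_zpow_sq {q : ℝ} (h0 : 0 < q) (h1 : q < 1) :
    ∑' j : ℤ, q ^ (j ^ 2) * (1 : ℝ) ^ j =
      eulerProd (q ^ 2) ^ 5 / (eulerProd q ^ 2 * eulerProd (q ^ 4) ^ 2) := by
  have hE1 := (eulerProd_pos q).ne'
  have hE2 := (eulerProd_pos (q ^ 2)).ne'
  have hE4 := (eulerProd_pos (q ^ 4)).ne'
  have h := tendsto_triple_product h0 h1 one_ne_zero (summable_zpow_sq h0 h1)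
  have h' := (tendsto_prod_one_add_odd h0 h1).mul (tendsto_prod_one_add_odd h0 h1)
  have e := tendsto_nhds_unique h (h'.congr fun n => by
    rw [← Finset.prod_mul_distrib]
    exact Finset.prod_congr rfl fun k _ => by norm_num)
  field_simp at e ⊢
  linear_combination e

theorem tsum_zpow_sq_add {q : ℝ} (h0 : 0 < q) (h1 : q < 1) :
    ∑' j : ℤ, q ^ (j ^ 2) * q ^ j = 2 * eulerProd (q ^ 4) ^ 2 / eulerProd (q ^ 2) := by
  have hQ0 : 0 < q ^ 2 := by positivity
  have hQ1 : q ^ 2 < 1 := pow_lt_one₀ h0.le h1 two_ne_zero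
  have hE2 := (eulerProd_pos (q ^ 2)).ne'
  have h := (tendsto_add_atTop_iff_nat 1).mpr
    (tendsto_triple_product h0 h1 h0.ne' (summable_zpow_sq_add h0 h1))
  have hp := tendsto_prod_one_add_pow hQ0 hQ1
  rw [show (q ^ 2) ^ 2 = q ^ 4 by ring] at hp
  have h' := ((tendsto_add_atTop_iff_nat 1).mpr hp).mul (hp.mul_const 2)
  have e := tendsto_nhds_unique h (h'.congr fun n => by
    rw [Finset.prod_mul_distrib]
    congr 1
    · exact Finset.prod_congr rfl fun k _ => by ring
    · rw [Finset.prod_range_succ']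
      congr 1
      · refine Finset.prod_congr rfl fun k _ => ?_
        field_simp
        ring
      · field_simp
        ring)
  field_simp at e ⊢
  linear_combination e

end ThetaProducts

section JacobiQuartic

open Set

theorem tsum_zpow_sq_add_sq {p : ℝ} (h0 : 0 < p) (h1 : p < 1) :
    (∑' j : ℤ, p ^ (j ^ 2) * (1 : ℝ) ^ j) ^ 2 + (∑' j : ℤ, p ^ (j ^ 2) * (-1 : ℝ) ^ j) ^ 2 =
      2 * (∑' j : ℤ, (p ^ 2) ^ (j ^ 2) * (1 : ℝ) ^ j) ^ 2 := by
  have hA := summable_zpow_sq h0 h1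
  have hB := summable_alternating_zpow_sq h0 h1
  have hC := summable_zpow_sq (pow_pos h0 2) (pow_lt_one₀ h0.le h1 two_ne_zero)
  rw [pow_two (∑' j : ℤ, _), pow_two (∑' j : ℤ, _), pow_two (∑' j : ℤ, _),
    tsum_mul_tsum_of_summable_norm hA hA, tsum_mul_tsum_of_summable_norm hB hB,
    tsum_mul_tsum_of_summable_norm hC hC,
    ← (summable_mul_of_summable_norm hA hA).tsum_add (summable_mul_of_summable_norm hB hB),
    ← tsum_mul_left]
  have hinj : Function.Injective fun c : ℤ × ℤ => (c.1 + c.2, c.1 - c.2) := by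
    rintro ⟨a, b⟩ ⟨c, d⟩ h
    simp only [Prod.mk.injEq] at h ⊢
    omega
  rw [← hinj.tsum_eq]
  · refine tsum_congr fun c => ?_
    have hs : (-1 : ℝ) ^ (c.1 + c.2) * (-1 : ℝ) ^ (c.1 - c.2) = 1 := by
      rw [← zpow_add₀ (by norm_num)]
      exact Even.neg_one_zpow ⟨c.1, by ring⟩
    have hp : p ^ ((c.1 + c.2) ^ 2) * p ^ ((c.1 - c.2) ^ 2) =
        (p ^ 2) ^ (c.1 ^ 2) * (p ^ 2) ^ (c.2 ^ 2) := by
      rw [← zpow_natCast p 2, ← zpow_mul, ← zpow_mul, ← zpow_add₀ h0.ne', ← zpow_add₀ h0.ne']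
      congr 1
      push_cast
      ring
    simp only [one_zpow, mul_one]
    linear_combination (1 + (-1 : ℝ) ^ (c.1 + c.2) * (-1 : ℝ) ^ (c.1 - c.2)) * hp +
      (p ^ 2) ^ (c.1 ^ 2) * (p ^ 2) ^ (c.2 ^ 2) * hs
  · intro c hc
    rcases Int.even_or_odd (c.1 + c.2) with ⟨a, ha⟩ | hodd
    · exact ⟨(a, a - c.2), Prod.ext (by simp; omega) (by simp)⟩
    · refine absurd ?_ hc
      have hs : (-1 : ℝ) ^ c.1 * (-1 : ℝ) ^ c.2 = -1 := by
        rw [← zpow_add₀ (by norm_num)]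
        exact hodd.neg_one_zpow
      simp only [one_zpow, mul_one]
      linear_combination p ^ (c.1 ^ 2) * p ^ (c.2 ^ 2) * hs

theorem tsum_zpow_sq_sub_sq {p : ℝ} (h0 : 0 < p) (h1 : p < 1) :
    (∑' j : ℤ, p ^ (j ^ 2) * (1 : ℝ) ^ j) ^ 2 - (∑' j : ℤ, p ^ (j ^ 2) * (-1 : ℝ) ^ j) ^ 2 =
      2 * p * (∑' j : ℤ, (p ^ 2) ^ (j ^ 2) * (p ^ 2) ^ j) ^ 2 := by
  have hA := summable_zpow_sq h0 h1
  have hB := summable_alternating_zpow_sq h0 h1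
  have hC := summable_zpow_sq_add (pow_pos h0 2) (pow_lt_one₀ h0.le h1 two_ne_zero)
  rw [pow_two (∑' j : ℤ, _), pow_two (∑' j : ℤ, _), pow_two (∑' j : ℤ, _),
    tsum_mul_tsum_of_summable_norm hA hA, tsum_mul_tsum_of_summable_norm hB hB,
    tsum_mul_tsum_of_summable_norm hC hC,
    ← (summable_mul_of_summable_norm hA hA).tsum_sub (summable_mul_of_summable_norm hB hB),
    ← tsum_mul_left]
  have hinj : Function.Injective fun c : ℤ × ℤ => (c.1 + c.2 + 1, c.1 - c.2) := by
    rintro ⟨a, b⟩ ⟨c, d⟩ h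
    simp only [Prod.mk.injEq] at h ⊢
    omega
  rw [← hinj.tsum_eq]
  · refine tsum_congr fun c => ?_
    have hs : (-1 : ℝ) ^ (c.1 + c.2 + 1) * (-1 : ℝ) ^ (c.1 - c.2) = -1 := by
      rw [← zpow_add₀ (by norm_num)]
      exact Odd.neg_one_zpow ⟨c.1, by ring⟩
    have hp : p ^ ((c.1 + c.2 + 1) ^ 2) * p ^ ((c.1 - c.2) ^ 2) =
        p * ((p ^ 2) ^ (c.1 ^ 2) * (p ^ 2) ^ c.1 * ((p ^ 2) ^ (c.2 ^ 2) * (p ^ 2) ^ c.2)) := by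
      rw [← zpow_add₀ (pow_pos h0 2).ne', ← zpow_add₀ (pow_pos h0 2).ne',
        ← zpow_natCast p 2, ← zpow_mul, ← zpow_mul, ← zpow_add₀ h0.ne', ← zpow_add₀ h0.ne',
        ← zpow_one_add₀ h0.ne']
      congr 1
      push_cast
      ring
    simp only [one_zpow, mul_one]
    linear_combination (1 - (-1 : ℝ) ^ (c.1 + c.2 + 1) * (-1 : ℝ) ^ (c.1 - c.2)) * hp -
      p * ((p ^ 2) ^ (c.1 ^ 2) * (p ^ 2) ^ c.1 * ((p ^ 2) ^ (c.2 ^ 2) * (p ^ 2) ^ c.2)) * hs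
  · intro c hc
    rcases Int.even_or_odd (c.1 + c.2) with heven | ⟨a, ha⟩
    · refine absurd ?_ hc
      have hs : (-1 : ℝ) ^ c.1 * (-1 : ℝ) ^ c.2 = 1 := by
        rw [← zpow_add₀ (by norm_num)]
        exact heven.neg_one_zpow
      simp only [one_zpow, mul_one]
      linear_combination -(p ^ (c.1 ^ 2) * p ^ (c.2 ^ 2) * hs)
    · exact ⟨(a, a - c.2), Prod.ext (by simp; omega) (by simp)⟩

/-- **Jacobi's quartic identity** in terms of the nome `p ^ 2`. -/
theorem tsum_zpow_sq_pow_four {p : ℝ} (h0 : 0 < p) (h1 : p < 1) :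
    (∑' j : ℤ, (p ^ 2) ^ (j ^ 2) * (1 : ℝ) ^ j) ^ 4 -
        p ^ 2 * (∑' j : ℤ, (p ^ 2) ^ (j ^ 2) * (p ^ 2) ^ j) ^ 4 =
      (∑' j : ℤ, (p ^ 2) ^ (j ^ 2) * (-1 : ℝ) ^ j) ^ 4 := by
  have hadd := tsum_zpow_sq_add_sq h0 h1
  have hsub := tsum_zpow_sq_sub_sq h0 h1
  have hmul : (∑' j : ℤ, p ^ (j ^ 2) * (1 : ℝ) ^ j) * (∑' j : ℤ, p ^ (j ^ 2) * (-1 : ℝ) ^ j) =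
      (∑' j : ℤ, (p ^ 2) ^ (j ^ 2) * (-1 : ℝ) ^ j) ^ 2 := by
    have hE1 := (eulerProd_pos p).ne'
    have hE2 := (eulerProd_pos (p ^ 2)).ne'
    have hE4 := (eulerProd_pos (p ^ 4)).ne'
    rw [tsum_zpow_sq h0 h1, tsum_alternating_zpow_sq h0 h1,
      tsum_alternating_zpow_sq (pow_pos h0 2) (pow_lt_one₀ h0.le h1 two_ne_zero),
      show (p ^ 2) ^ 2 = p ^ 4 by ring]
    field_simp
  generalize (∑' j : ℤ, p ^ (j ^ 2) * (1 : ℝ) ^ j) = a at *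
  generalize (∑' j : ℤ, p ^ (j ^ 2) * (-1 : ℝ) ^ j) = b at *
  generalize (∑' j : ℤ, (p ^ 2) ^ (j ^ 2) * (1 : ℝ) ^ j) = A at *
  generalize (∑' j : ℤ, (p ^ 2) ^ (j ^ 2) * (-1 : ℝ) ^ j) = B at *
  generalize (∑' j : ℤ, (p ^ 2) ^ (j ^ 2) * (p ^ 2) ^ j) = C at *
  have ha : a ^ 2 = A ^ 2 + p * C ^ 2 := by linarith
  have hb : b ^ 2 = A ^ 2 - p * C ^ 2 := by linarith
  calc A ^ 4 - p ^ 2 * C ^ 4 = a ^ 2 * b ^ 2 := by rw [ha, hb]; ring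
    _ = (a * b) ^ 2 := by ring
    _ = B ^ 4 := by rw [hmul]; ring

end JacobiQuartic

/-! ### The singular value at `58` -/

theorem theta3_eq_tsum_zpow (q : ℝ) : theta3 q = ∑' j : ℤ, q ^ (j ^ 2) * (1 : ℝ) ^ j := by
  refine tsum_congr fun j => ?_
  rw [one_zpow, mul_one, ← Real.rpow_intCast]
  push_cast
  rfl

theorem theta2_sq_eq_tsum_zpow {p : ℝ} (h0 : 0 < p) :
    theta2 (p ^ 2) ^ 2 = p * (∑' j : ℤ, (p ^ 2) ^ (j ^ 2) * (p ^ 2) ^ j) ^ 2 := by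
  have hQ0 : 0 < p ^ 2 := by positivity
  have h : theta2 (p ^ 2) =
      (p ^ 2) ^ ((1 : ℝ) / 4) * ∑' j : ℤ, (p ^ 2) ^ (j ^ 2) * (p ^ 2) ^ j := by
    rw [theta2, ← tsum_mul_left]
    refine tsum_congr fun j => ?_
    rw [← Real.rpow_intCast, ← Real.rpow_intCast, ← Real.rpow_add hQ0, ← Real.rpow_add hQ0]
    congr 1
    push_cast
    ring
  rw [h, mul_pow, ← Real.rpow_natCast (_ ^ _), ← Real.rpow_mul hQ0.le, ← Real.rpow_natCast p,
    ← Real.rpow_mul h0.le]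
  norm_num

/-- The twelfth power of the Ramanujan invariant as an eta quotient. -/
theorem one_sub_theta_ratio_sq_div {p : ℝ} (h0 : 0 < p) (h1 : p < 1) :
    0 < theta2 (p ^ 2) ^ 2 / theta3 (p ^ 2) ^ 2 ∧
      (1 - (theta2 (p ^ 2) ^ 2 / theta3 (p ^ 2) ^ 2) ^ 2) /
          (2 * (theta2 (p ^ 2) ^ 2 / theta3 (p ^ 2) ^ 2)) =
        eulerProd (p ^ 2) ^ 12 / (8 * p * eulerProd ((p ^ 2) ^ 2) ^ 12) := by
  have hQ0 : 0 < p ^ 2 := by positivity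
  have hQ1 : p ^ 2 < 1 := pow_lt_one₀ h0.le h1 two_ne_zero
  have hE1 := eulerProd_pos (p ^ 2)
  have hE2 := eulerProd_pos ((p ^ 2) ^ 2)
  have hE4 := eulerProd_pos ((p ^ 2) ^ 4)
  have hJ := tsum_zpow_sq_pow_four h0 h1
  rw [theta2_sq_eq_tsum_zpow h0, theta3_eq_tsum_zpow]
  rw [tsum_zpow_sq hQ0 hQ1, tsum_zpow_sq_add hQ0 hQ1, tsum_alternating_zpow_sq hQ0 hQ1] at *
  refine ⟨by positivity, ?_⟩
  generalize eulerProd (p ^ 2) = a at *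
  generalize eulerProd ((p ^ 2) ^ 2) = b at *
  generalize eulerProd ((p ^ 2) ^ 4) = c at *
  field_simp at hJ ⊢
  linear_combination 8 * hJ

theorem eulerProd_ratio_58 :
    eulerProd (Real.exp (-(π * √58))) ^ 12 /
        (8 * Real.exp (-(π * √58) / 2) * eulerProd (Real.exp (-(π * √58)) ^ 2) ^ 12) =
      9801 + 1820 * √29 := by
  have hK := kronecker_limit_58
  have h8 : Real.exp (3 * Real.log 2) = 8 := by
    rw [show (3 : ℝ) * Real.log 2 = Real.log (2 ^ 3) by rw [Real.log_pow]; norm_num,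
      Real.exp_log (by norm_num)]
    norm_num
  have hu : Real.exp (6 * Real.log ((5 + √29) / 2)) = 9801 + 1820 * √29 := by
    rw [show (6 : ℝ) * Real.log ((5 + √29) / 2) = Real.log (((5 + √29) / 2) ^ 6) by
        rw [Real.log_pow]; norm_num, Real.exp_log (by positivity)]
    have h29 : √29 ^ 2 = 29 := Real.sq_sqrt (by norm_num)
    generalize √29 = t at *
    have h2 : ((5 + t) / 2) ^ 2 = (27 + 5 * t) / 2 := by linear_combination h29 / 4
    rw [show ((5 + t) / 2) ^ 6 = (((5 + t) / 2) ^ 2) ^ 3 by ring, h2]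
    linear_combination (125 / 8 * t + 2025 / 8) * h29
  rw [← hu, ← h8, ← hK, eulerProd, eulerProd, ← Real.exp_nat_mul, ← Real.exp_nat_mul,
    ← Real.exp_add, ← Real.exp_add, ← Real.exp_sub]
  congr 1
  push_cast
  ring

/-- The singular value at 58 is `k₅₈ = (√2 − 1)⁶·(13√58 − 99)`, and moreover
`x₅₈ = 2/(g₅₈¹² + g₅₈⁻¹²) = 1/9801`. -/
theorem k_58_and_x_58 :
    kSing 58 = (Real.sqrt 2 - 1) ^ 6 * (13 * Real.sqrt 58 - 99) ∧
    2 / (gRam 58 ^ 12 + gRam 58 ^ (-12 : ℤ)) = 1 / 9801 := by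
  have hp : Real.exp (-(π * √58) / 2) ^ 2 = Real.exp (-(π * √58)) := by
    rw [← Real.exp_nat_mul]
    congr 1
    push_cast
    ring
  have hp1 : Real.exp (-(π * √58) / 2) < 1 := by
    rw [Real.exp_lt_one_iff]
    have : 0 < π * √58 := by positivity
    linarith
  obtain ⟨hk0, hkG⟩ := one_sub_theta_ratio_sq_div (Real.exp_pos _) hp1
  rw [hp, eulerProd_ratio_58] at hkG
  rw [hp] at hk0
  change 0 < kSing 58 at hk0
  change (1 - kSing 58 ^ 2) / (2 * kSing 58) = _ at hkG
  have h29 : √29 ^ 2 = 29 := Real.sq_sqrt (by norm_num)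
  have h2 : √2 ^ 2 = 2 := Real.sq_sqrt (by norm_num)
  have hG0 : 0 < 9801 + 1820 * √29 := by positivity
  constructor
  · have hunit : (√2 - 1) ^ 6 = 99 - 70 * √2 := by
      rw [show (√2 - 1) ^ 6 = ((√2 - 1) ^ 2) ^ 3 by ring,
        show (√2 - 1) ^ 2 = 3 - 2 * √2 by linear_combination h2]
      linear_combination (36 - 8 * √2) * h2
    have hK0 : 0 < (√2 - 1) ^ 6 * (13 * √58 - 99) := by
      have h58 : √58 ^ 2 = 58 := Real.sq_sqrt (by norm_num)
      have hs : 1 < √2 := by nlinarith [Real.sqrt_nonneg 2]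
      have ht : 99 < 13 * √58 := by nlinarith [Real.sqrt_nonneg 58]
      exact mul_pos (pow_pos (sub_pos.mpr hs) 6) (sub_pos.mpr ht)
    rw [div_eq_iff (by positivity)] at hkG
    have hroot : ((√2 - 1) ^ 6 * (13 * √58 - 99)) ^ 2 +
        2 * (9801 + 1820 * √29) * ((√2 - 1) ^ 6 * (13 * √58 - 99)) - 1 = 0 := by
      have hsum : (√2 - 1) ^ 6 * (13 * √58 - 99) + (9801 + 1820 * √29) =
          √2 * (1287 * √29 + 6930) := by
        rw [hunit, sqrt_58_eq]
        linear_combination (-910 * √29) * h2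
      linear_combination ((√2 - 1) ^ 6 * (13 * √58 - 99) + (9801 + 1820 * √29) +
          √2 * (1287 * √29 + 6930)) * hsum +
        (1287 * √29 + 6930) ^ 2 * h2 + (2 * 1287 ^ 2 - 1820 ^ 2) * h29
    generalize (√2 - 1) ^ 6 * (13 * √58 - 99) = K at *
    have hprod : (kSing 58 - K) * (kSing 58 + K + 2 * (9801 + 1820 * √29)) = 0 := by
      linear_combination -hkG - hroot
    rcases mul_eq_zero.mp hprod with h | h
    · exact sub_eq_zero.mp h
    · linarith
  · have hg : gRam 58 ^ 12 = 9801 + 1820 * √29 := by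
      rw [gRam, hkG, ← Real.rpow_natCast, ← Real.rpow_mul hG0.le]
      norm_num
    have hinv : (9801 + 1820 * √29)⁻¹ = 9801 - 1820 * √29 :=
      inv_eq_of_mul_eq_one_right (by linear_combination (-1820 ^ 2) * h29)
    rw [zpow_neg, show gRam 58 ^ (12 : ℤ) = gRam 58 ^ 12 from mod_cast zpow_natCast (gRam 58) 12,
      hg, hinv]
    norm_num
end

section
/- Jacobi's inversion identity for the complete elliptic integral: for every q with 0 < q < 1, setting k = θ₂(q)²/θ₃(q)², one has K(k) = (π/2)·θ₃(q)². -/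
open Real

/-- The complete elliptic integral of the first kind. -/
noncomputable def EllipticK (k : ℝ) : ℝ :=
  ∫ θ in (0:ℝ)..(π / 2), 1 / Real.sqrt (1 - k ^ 2 * Real.sin θ ^ 2)

open Filter Topology Set MeasureTheory

theorem summable_rpow_shifted_sq {q : ℝ} (hq0 : 0 < q) (hq1 : q < 1) (a : ℝ) :
    Summable fun n : ℤ ↦ q ^ (((n : ℝ) + a) ^ 2) := by
  have ht : 0 < -log q / π := div_pos (neg_pos.2 (log_neg hq0 hq1)) pi_pos
  refine (HurwitzZeta.hasSum_int_evenKernel a ht).summable.congr fun n ↦ ?_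
  rw [rpow_def_of_pos hq0]
  congr 1
  field_simp

theorem summable_rpow_sq {q : ℝ} (hq0 : 0 < q) (hq1 : q < 1) :
    Summable fun n : ℤ ↦ q ^ ((n : ℝ) ^ 2) := by
  simpa using summable_rpow_shifted_sq hq0 hq1 0

theorem theta3_pos {q : ℝ} (hq0 : 0 < q) (hq1 : q < 1) : 0 < theta3 q :=
  (summable_rpow_sq hq0 hq1).tsum_pos (fun _ ↦ (rpow_pos_of_pos hq0 _).le) 0
    (rpow_pos_of_pos hq0 _)

theorem theta2_nonneg {q : ℝ} (hq0 : 0 < q) : 0 ≤ theta2 q :=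
  tsum_nonneg fun _ ↦ (rpow_pos_of_pos hq0 _).le

theorem hasSum_rpow_mul_rpow {q : ℝ} (hq0 : 0 < q) (hq1 : q < 1) (a b : ℝ) :
    HasSum (fun p : ℤ × ℤ ↦ q ^ (((p.1 : ℝ) + a) ^ 2 + ((p.2 : ℝ) + b) ^ 2))
      ((∑' n : ℤ, q ^ (((n : ℝ) + a) ^ 2)) * ∑' n : ℤ, q ^ (((n : ℝ) + b) ^ 2)) := by
  have ha := summable_rpow_shifted_sq hq0 hq1 a
  have hb := summable_rpow_shifted_sq hq0 hq1 b
  have hab := ha.mul_of_nonneg hb (fun _ ↦ (rpow_pos_of_pos hq0 _).le)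
    fun _ ↦ (rpow_pos_of_pos hq0 _).le
  simp only [rpow_add hq0]
  rw [ha.tsum_mul_tsum hb hab]
  exact hab.hasSum

theorem bijective_add_sub_sumElim_add_one :
    Function.Bijective (Sum.elim (fun p : ℤ × ℤ ↦ (p.1 + p.2, p.1 - p.2))
      (fun p : ℤ × ℤ ↦ (p.1 + p.2 + 1, p.1 - p.2))) := by
  constructor
  · rintro (⟨a, b⟩ | ⟨a, b⟩) (⟨c, d⟩ | ⟨c, d⟩) h <;>
      simp only [Sum.elim_inl, Sum.elim_inr, Prod.mk.injEq] at h <;>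
      simp only [Sum.inl.injEq, Sum.inr.injEq, Prod.mk.injEq, reduceCtorEq] <;> omega
  · rintro ⟨u, v⟩
    rcases Int.even_or_odd' (u + v) with ⟨c, hc | hc⟩
    · exact ⟨.inl (c, u - c), by simp only [Sum.elim_inl, Prod.mk.injEq]; omega⟩
    · exact ⟨.inr (c, u - 1 - c), by simp only [Sum.elim_inr, Prod.mk.injEq]; omega⟩

theorem bijective_add_sub_sumElim_sub_one :
    Function.Bijective (Sum.elim (fun p : ℤ × ℤ ↦ (p.1 + p.2, p.1 - p.2))
      (fun p : ℤ × ℤ ↦ (p.1 + p.2, p.1 - p.2 - 1))) := by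
  constructor
  · rintro (⟨a, b⟩ | ⟨a, b⟩) (⟨c, d⟩ | ⟨c, d⟩) h <;>
      simp only [Sum.elim_inl, Sum.elim_inr, Prod.mk.injEq] at h <;>
      simp only [Sum.inl.injEq, Sum.inr.injEq, Prod.mk.injEq, reduceCtorEq] <;> omega
  · rintro ⟨u, v⟩
    rcases Int.even_or_odd' (u + v) with ⟨c, hc | hc⟩
    · exact ⟨.inl (c, u - c), by simp only [Sum.elim_inl, Prod.mk.injEq]; omega⟩
    · exact ⟨.inr (c + 1, u - 1 - c), by simp only [Sum.elim_inr, Prod.mk.injEq]; omega⟩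

theorem sq_rpow {q : ℝ} (hq0 : 0 < q) (x : ℝ) : (q ^ 2) ^ x = q ^ (2 * x) := by
  rw [rpow_mul hq0.le, rpow_two]

theorem theta3_sq {q : ℝ} (hq0 : 0 < q) (hq1 : q < 1) :
    theta3 q ^ 2 = theta3 (q ^ 2) ^ 2 + theta2 (q ^ 2) ^ 2 := by
  have hq2 : q ^ 2 < 1 := by nlinarith
  have h := hasSum_rpow_mul_rpow hq0 hq1 0 0
  have h₁ := hasSum_rpow_mul_rpow (pow_pos hq0 2) hq2 0 0
  have h₂ := hasSum_rpow_mul_rpow (pow_pos hq0 2) hq2 (1 / 2) (1 / 2)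
  rw [← (Equiv.ofBijective _ bijective_add_sub_sumElim_add_one).hasSum_iff] at h
  have h' := h.unique (HasSum.sum (h₁.congr_fun ?_) (h₂.congr_fun ?_))
  · simpa [theta3, theta2, sq] using h'
  all_goals
    rintro ⟨a, b⟩
    rw [sq_rpow hq0]
    simp only [Function.comp_apply, Equiv.ofBijective_apply, Sum.elim_inl, Sum.elim_inr]
    congr 1
    push_cast
    ring

theorem theta2_sq {q : ℝ} (hq0 : 0 < q) (hq1 : q < 1) :
    theta2 q ^ 2 = 2 * theta2 (q ^ 2) * theta3 (q ^ 2) := by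
  have hq2 : q ^ 2 < 1 := by nlinarith
  have h := hasSum_rpow_mul_rpow hq0 hq1 (1 / 2) (1 / 2)
  have h₁ := hasSum_rpow_mul_rpow (pow_pos hq0 2) hq2 (1 / 2) 0
  have h₂ := hasSum_rpow_mul_rpow (pow_pos hq0 2) hq2 0 (1 / 2)
  rw [← (Equiv.ofBijective _ bijective_add_sub_sumElim_sub_one).hasSum_iff] at h
  have h' := h.unique (HasSum.sum (h₁.congr_fun ?_) (h₂.congr_fun ?_))
  · simp only [add_zero] at h'
    simp only [theta2, theta3]
    linear_combination h'
  all_goals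
    rintro ⟨a, b⟩
    rw [sq_rpow hq0]
    simp only [Function.comp_apply, Equiv.ofBijective_apply, Sum.elim_inl, Sum.elim_inr]
    congr 1
    push_cast
    ring

theorem tendsto_rpow_of_tendsto_zero {x : ℕ → ℝ} (hx : Tendsto x atTop (𝓝 0)) {y : ℝ}
    (hy : 0 < y) : Tendsto (fun n ↦ x n ^ y) atTop (𝓝 0) := by
  simpa [zero_rpow hy.ne'] using hx.rpow_const (Or.inr hy.le)

theorem tendsto_pow_two_pow {q : ℝ} (hq0 : 0 < q) (hq1 : q < 1) :
    Tendsto (fun n : ℕ ↦ q ^ 2 ^ n) atTop (𝓝 0) :=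
  (tendsto_pow_atTop_nhds_zero_of_lt_one hq0.le hq1).comp
    (tendsto_pow_atTop_atTop_of_one_lt one_lt_two)

theorem norm_pow_two_pow_rpow_le {q : ℝ} (hq0 : 0 < q) (hq1 : q < 1) (n : ℕ) {y : ℝ}
    (hy : 0 ≤ y) : ‖(q ^ 2 ^ n) ^ y‖ ≤ q ^ y := by
  rw [norm_of_nonneg (by positivity)]
  exact rpow_le_rpow (by positivity)
    (pow_le_of_le_one hq0.le hq1.le (pow_ne_zero n two_ne_zero)) hy

theorem tendsto_theta2 {q : ℝ} (hq0 : 0 < q) (hq1 : q < 1) :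
    Tendsto (fun n : ℕ ↦ theta2 (q ^ 2 ^ n)) atTop (𝓝 0) := by
  rw [← tsum_zero (α := ℝ) (β := ℤ)]
  refine tendsto_tsum_of_dominated_convergence (summable_rpow_shifted_sq hq0 hq1 (1 / 2))
    (fun k ↦ tendsto_rpow_of_tendsto_zero (tendsto_pow_two_pow hq0 hq1) (sq_pos_of_ne_zero ?_))
    (.of_forall fun n k ↦ norm_pow_two_pow_rpow_le hq0 hq1 n (sq_nonneg _))
  intro h
  have : (2 * k + 1 : ℝ) = 0 := by linarith
  norm_cast at this
  omega

theorem tendsto_theta3 {q : ℝ} (hq0 : 0 < q) (hq1 : q < 1) :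
    Tendsto (fun n : ℕ ↦ theta3 (q ^ 2 ^ n)) atTop (𝓝 1) := by
  rw [← tsum_ite_eq (0 : ℤ) (fun _ ↦ (1 : ℝ))]
  refine tendsto_tsum_of_dominated_convergence (summable_rpow_sq hq0 hq1) (fun k ↦ ?_)
    (.of_forall fun n k ↦ norm_pow_two_pow_rpow_le hq0 hq1 n (sq_nonneg _))
  split_ifs with hk
  · simp [hk]
  · exact tendsto_rpow_of_tendsto_zero (tendsto_pow_two_pow hq0 hq1) (by positivity)

theorem one_sub_sq_mul_sin_sq_pos {k : ℝ} (hk0 : 0 ≤ k) (hk1 : k < 1) (x : ℝ) :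
    0 < 1 - k ^ 2 * sin x ^ 2 := by
  have h1 : k ^ 2 < 1 := by nlinarith
  nlinarith [sin_sq_le_one x, sq_nonneg (sin x), sq_nonneg k]

theorem continuous_one_div_sqrt {k : ℝ} (hk0 : 0 ≤ k) (hk1 : k < 1) :
    Continuous fun x : ℝ ↦ 1 / √(1 - k ^ 2 * sin x ^ 2) :=
  continuous_const.div (by fun_prop) fun x ↦
    (sqrt_pos.2 (one_sub_sq_mul_sin_sq_pos hk0 hk1 x)).ne'

/-- The derivative of the amplitude substitution in the Landen transformation. -/
theorem hasDerivAt_landen {m x : ℝ} (hm0 : 0 ≤ m) (hm1 : m < 1) (hx : x ∈ Ioo 0 (π / 2)) :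
    HasDerivAt (fun x ↦ arcsin ((1 + m) * sin x / (1 + m * sin x ^ 2)))
      ((1 + m) * (1 - m * sin x ^ 2) / ((1 + m * sin x ^ 2) * √(1 - m ^ 2 * sin x ^ 2))) x := by
  have hs0 : 0 < sin x := sin_pos_of_pos_of_lt_pi hx.1 (by linarith [hx.2, pi_pos])
  have hc0 : 0 < cos x := cos_pos_of_mem_Ioo ⟨by linarith [hx.1, pi_pos], hx.2⟩
  have hsc := sin_sq_add_cos_sq x
  have hs1 : sin x < 1 := by nlinarith
  have hd : 0 < 1 + m * sin x ^ 2 := by positivity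
  have hw := one_sub_sq_mul_sin_sq_pos hm0 hm1 x
  have hu0 : 0 < (1 + m) * sin x / (1 + m * sin x ^ 2) := by positivity
  have hms : m * sin x < 1 := by nlinarith
  have hu1 : (1 + m) * sin x / (1 + m * sin x ^ 2) < 1 := by
    rw [div_lt_one hd]
    nlinarith [mul_pos (sub_pos.2 hs1) (sub_pos.2 hms)]
  have hu : HasDerivAt (fun x ↦ (1 + m) * sin x / (1 + m * sin x ^ 2))
      ((1 + m) * cos x * (1 - m * sin x ^ 2) / (1 + m * sin x ^ 2) ^ 2) x := by
    refine (((hasDerivAt_sin x).const_mul (1 + m)).div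
      ((((hasDerivAt_sin x).pow 2).const_mul m).const_add 1) hd.ne').congr_deriv ?_
    simp only [Pi.pow_apply, Nat.cast_ofNat]
    congr 1
    ring
  have hsq : √(1 - ((1 + m) * sin x / (1 + m * sin x ^ 2)) ^ 2) =
      cos x * √(1 - m ^ 2 * sin x ^ 2) / (1 + m * sin x ^ 2) := by
    rw [sqrt_eq_iff_mul_self_eq_of_pos (by positivity)]
    field_simp
    rw [sq_sqrt hw.le, cos_sq']
    ring
  refine ((hasDerivAt_arcsin (by linarith) hu1.ne).comp x hu).congr_deriv ?_
  rw [hsq]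
  have := sqrt_pos.2 hw
  field_simp

/-- The ascending Landen transformation of the complete elliptic integral. -/
theorem ellipticK_landen {s : ℝ} (hs0 : 0 ≤ s) (hs1 : s < 1) :
    EllipticK (2 * s / (1 + s ^ 2)) = (1 + s ^ 2) * EllipticK (s ^ 2) := by
  set m := s ^ 2 with hm
  have hm0 : 0 ≤ m := sq_nonneg s
  have hm1 : m < 1 := by nlinarith
  have hk0 : 0 ≤ 2 * s / (1 + m) := by positivity
  have hk1 : 2 * s / (1 + m) < 1 := by
    rw [div_lt_one (by positivity)]
    nlinarith [sq_pos_of_pos (sub_pos.2 hs1)]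
  have hd (x : ℝ) : 0 < 1 + m * sin x ^ 2 := by positivity
  have hw := one_sub_sq_mul_sin_sq_pos hm0 hm1
  have hg := continuous_one_div_sqrt hk0 hk1
  have hf : Continuous fun x ↦ arcsin ((1 + m) * sin x / (1 + m * sin x ^ 2)) :=
    continuous_arcsin.comp (Continuous.div (by fun_prop) (by fun_prop) fun x ↦ (hd x).ne')
  have hf' : Continuous fun x ↦
      (1 + m) * (1 - m * sin x ^ 2) / ((1 + m * sin x ^ 2) * √(1 - m ^ 2 * sin x ^ 2)) :=
    Continuous.div (by fun_prop) (by fun_prop) fun x ↦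
      (mul_pos (hd x) (sqrt_pos.2 (hw x))).ne'
  have key := intervalIntegral.integral_comp_mul_deriv''' (a := 0) (b := π / 2) hf.continuousOn
    (fun x hx ↦ (hasDerivAt_landen hm0 hm1 (by
      simpa [min_eq_left pi_div_two_pos.le, max_eq_right pi_div_two_pos.le]
        using hx)).hasDerivWithinAt)
    hg.continuousOn
    (hg.continuousOn.integrableOn_compact (isCompact_uIcc.image hf))
    (((hg.comp hf).mul hf').continuousOn.integrableOn_compact isCompact_uIcc)
  have h1m : (1 + m) ≠ 0 := by positivity
  simp only [sin_zero, sin_pi_div_two, mul_zero, zero_div, arcsin_zero, mul_one, one_pow,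
    div_self h1m, arcsin_one] at key
  rw [EllipticK, ← key, EllipticK, ← intervalIntegral.integral_const_mul]
  refine intervalIntegral.integral_congr fun x hx ↦ ?_
  rw [uIcc_of_le pi_div_two_pos.le] at hx
  have hx0 : 0 ≤ sin x := sin_nonneg_of_nonneg_of_le_pi hx.1 (by linarith [hx.2, pi_pos])
  have hx1 := sin_le_one x
  have hms : m * sin x ≤ 1 := by nlinarith
  have hms2 : 0 < 1 - m * sin x ^ 2 := by nlinarith [sin_sq_le_one x]
  have hu1 : (1 + m) * sin x / (1 + m * sin x ^ 2) ≤ 1 := by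
    rw [div_le_one (hd x)]
    nlinarith [mul_nonneg (sub_nonneg.2 hx1) (sub_nonneg.2 hms)]
  have hu0 : 0 ≤ (1 + m) * sin x / (1 + m * sin x ^ 2) := by positivity
  have hsq : √(1 - (2 * s / (1 + m)) ^ 2 * ((1 + m) * sin x / (1 + m * sin x ^ 2)) ^ 2) =
      (1 - m * sin x ^ 2) / (1 + m * sin x ^ 2) := by
    have := hd x
    rw [sqrt_eq_iff_mul_self_eq_of_pos (by positivity)]
    field_simp
    rw [hm]
    ring
  have := hd x
  have := sqrt_pos.2 (hw x)
  simp only [Function.comp_apply]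
  rw [sin_arcsin (by linarith) hu1, hsq]
  field_simp

theorem tendsto_ellipticK_zero : Tendsto EllipticK (𝓝[≥] 0) (𝓝 (π / 2)) := by
  have hlt : ∀ᶠ k : ℝ in 𝓝[≥] 0, k ∈ Ico (0 : ℝ) 1 := Ico_mem_nhdsGE one_pos
  have hup : Tendsto (fun k : ℝ ↦ π / 2 * (1 / √(1 - k ^ 2))) (𝓝[≥] 0) (𝓝 (π / 2)) := by
    have : ContinuousAt (fun k : ℝ ↦ π / 2 * (1 / √(1 - k ^ 2))) 0 := by
      refine continuousAt_const.mul (continuousAt_const.div (by fun_prop) (by simp))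
    simpa using this.tendsto.mono_left nhdsWithin_le_nhds
  refine tendsto_of_tendsto_of_tendsto_of_le_of_le' tendsto_const_nhds hup ?_ ?_
  all_goals
    filter_upwards [hlt] with k hk
    have hc := continuous_one_div_sqrt hk.1 hk.2
    have hpos := one_sub_sq_mul_sin_sq_pos hk.1 hk.2
  · have := intervalIntegral.integral_mono_on (μ := volume) pi_div_two_pos.le
      (continuous_const (y := (1 : ℝ)).intervalIntegrable _ _) (hc.intervalIntegrable _ _)
      fun x _ ↦ by
        rw [le_div_iff₀ (sqrt_pos.2 (hpos x)), one_mul, sqrt_le_one]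
        nlinarith [mul_nonneg (sq_nonneg k) (sq_nonneg (sin x))]
    simpa [EllipticK] using this
  · have := intervalIntegral.integral_mono_on (μ := volume) pi_div_two_pos.le (hc.intervalIntegrable _ _)
      (continuous_const (y := 1 / √(1 - k ^ 2)).intervalIntegrable _ _)
      fun x _ ↦ by
        have : 0 < 1 - k ^ 2 := by nlinarith [hk.1, hk.2]
        refine one_div_le_one_div_of_le (sqrt_pos.2 this) (sqrt_le_sqrt ?_)
        nlinarith [sin_sq_le_one x, sq_nonneg k]
    simpa [EllipticK] using this

theorem tendsto_theta2_div_theta3 {q : ℝ} (hq0 : 0 < q) (hq1 : q < 1) :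
    Tendsto (fun n : ℕ ↦ theta2 (q ^ 2 ^ n) / theta3 (q ^ 2 ^ n)) atTop (𝓝 0) := by
  simpa using! (tendsto_theta2 hq0 hq1).div (tendsto_theta3 hq0 hq1) one_ne_zero

theorem theta2_sq_div_theta3_sq {q : ℝ} (hq0 : 0 < q) (hq1 : q < 1) :
    theta2 q ^ 2 / theta3 q ^ 2 = 2 * (theta2 (q ^ 2) / theta3 (q ^ 2)) /
      (1 + (theta2 (q ^ 2) / theta3 (q ^ 2)) ^ 2) := by
  have h := theta3_pos (pow_pos hq0 2) (by nlinarith : q ^ 2 < 1)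
  rw [theta2_sq hq0 hq1, theta3_sq hq0 hq1]
  field_simp

theorem theta2_div_theta3_lt_one_of_sq {q : ℝ} (hq0 : 0 < q) (hq1 : q < 1)
    (h : theta2 (q ^ 2) / theta3 (q ^ 2) < 1) : theta2 q / theta3 q < 1 := by
  refine (sq_lt_one_iff₀ (div_nonneg (theta2_nonneg hq0) (theta3_pos hq0 hq1).le)).1 ?_
  rw [div_pow, theta2_sq_div_theta3_sq hq0 hq1, div_lt_one (by positivity)]
  nlinarith [sq_pos_of_pos (sub_pos.2 h)]

theorem theta2_div_theta3_lt_one {q : ℝ} (hq0 : 0 < q) (hq1 : q < 1) :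
    theta2 q / theta3 q < 1 := by
  obtain ⟨n, hn⟩ := ((tendsto_theta2_div_theta3 hq0 hq1).eventually_lt_const one_pos).exists
  induction n with
  | zero => simpa using hn
  | succ n ih =>
    refine ih (theta2_div_theta3_lt_one_of_sq (by positivity)
      (pow_lt_one₀ hq0.le hq1 (by positivity)) ?_)
    rwa [← pow_mul, ← pow_succ]

theorem ellipticK_div_theta3_sq {q : ℝ} (hq0 : 0 < q) (hq1 : q < 1) :
    EllipticK (theta2 q ^ 2 / theta3 q ^ 2) / theta3 q ^ 2 =
      EllipticK (theta2 (q ^ 2) ^ 2 / theta3 (q ^ 2) ^ 2) / theta3 (q ^ 2) ^ 2 := by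
  have hq2 : q ^ 2 < 1 := by nlinarith
  have h := theta3_pos (pow_pos hq0 2) hq2
  rw [theta2_sq_div_theta3_sq hq0 hq1, ellipticK_landen
    (div_nonneg (theta2_nonneg (pow_pos hq0 2)) h.le)
    (theta2_div_theta3_lt_one (pow_pos hq0 2) hq2), theta3_sq hq0 hq1, div_pow]
  field_simp

/-- Jacobi's inversion identity: for `0 < q < 1`, with `k = θ₂(q)²/θ₃(q)²`,
one has `K(k) = (π/2)·θ₃(q)²`. -/
theorem jacobi_inversion (q : ℝ) (hq0 : 0 < q) (hq1 : q < 1) :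
    EllipticK (theta2 q ^ 2 / theta3 q ^ 2) = π / 2 * theta3 q ^ 2 := by
  rw [← div_eq_iff (pow_pos (theta3_pos hq0 hq1) 2).ne']
  have hconst (n : ℕ) : EllipticK (theta2 (q ^ 2 ^ n) ^ 2 / theta3 (q ^ 2 ^ n) ^ 2) /
      theta3 (q ^ 2 ^ n) ^ 2 = EllipticK (theta2 q ^ 2 / theta3 q ^ 2) / theta3 q ^ 2 := by
    induction n with
    | zero => simp
    | succ n ih =>
      rw [← ih, ellipticK_div_theta3_sq (q := q ^ 2 ^ n) (by positivity)
        (pow_lt_one₀ hq0.le hq1 (by positivity)), ← pow_mul, ← pow_succ]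
  have hk : Tendsto (fun n : ℕ ↦ theta2 (q ^ 2 ^ n) ^ 2 / theta3 (q ^ 2 ^ n) ^ 2) atTop
      (𝓝[≥] 0) := by
    refine tendsto_nhdsWithin_iff.2 ⟨?_, .of_forall fun n ↦ mem_Ici.2 (by positivity)⟩
    simpa [div_pow] using (tendsto_theta2_div_theta3 hq0 hq1).pow 2
  have hlim := (tendsto_ellipticK_zero.comp hk).div ((tendsto_theta3 hq0 hq1).pow 2) (by simp)
  simp only [one_pow, div_one] at hlim
  exact tendsto_nhds_unique (tendsto_const_nhds.congr fun n ↦ (hconst n).symm) hlim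
end
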